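/- Let X be a one-ended proper CAT(0) metric space with visual boundary ∂X. If any two geodesic rays in X are properly homotopic and every strong shape component of ∂X is non-empty (i.e. every proper ray in X is properly homotopic to some proper ray that ends at a point of ∂X), then X has semistable fundamental group at infinity, i.e. any two proper rays in X are properly homotopic. -/

import Mathlib

open Set Filter Topology
open scoped NNReal unitInterval

/-- A geodesic metric space: any two points are joined by a geodesic segment
(a curve along which distances are realized). -/
def IsGeodesicSpace (X : Type*) [MetricSpace X] : Prop :=
  ∀ x y : X, ∃ γ : ℝ → X, γ 0 = x ∧ γ (dist x y) = y ∧
    ∀ s ∈ Icc (0 : ℝ) (dist x y), ∀ t ∈ Icc (0 : ℝ) (dist x y),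
      dist (γ s) (γ t) = |s - t|

/-- A CAT(0) space: a geodesic metric space in which every geodesic triangle satisfies the
CAT(0) comparison inequality; for geodesic spaces this is equivalent to the CN inequality of
Bruhat–Tits (comparison of distances to midpoints with the Euclidean comparison triangle). -/
def IsCAT0Space (X : Type*) [MetricSpace X] : Prop :=
  IsGeodesicSpace X ∧
    ∀ x y m z : X, dist x m = dist x y / 2 → dist y m = dist x y / 2 →
      dist z m ^ 2 ≤ dist z x ^ 2 / 2 + dist z y ^ 2 / 2 - dist x y ^ 2 / 4

/-- A proper ray in `X`: a continuous map `[0,∞) → X` such that preimages of compact sets are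
compact. -/
structure ProperRay (X : Type*) [MetricSpace X] where
  toFun : ℝ≥0 → X
  continuous_toFun : Continuous toFun
  isProper : ∀ K : Set X, IsCompact K → IsCompact (toFun ⁻¹' K)

/-- A geodesic ray in `X`: an isometric embedding of `[0,∞)` into `X`. -/
structure GeodesicRay (X : Type*) [MetricSpace X] where
  toFun : ℝ≥0 → X
  isometry : ∀ s t : ℝ≥0, dist (toFun s) (toFun t) = |(s : ℝ) - (t : ℝ)|

/-- Two rays `[0,∞) → X` are properly homotopic if there is a continuous proper homotopy
`H : [0,∞) × [0,1] → X` between them. -/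
def ProperlyHomotopic {X : Type*} [MetricSpace X] (c c' : ℝ≥0 → X) : Prop :=
  ∃ H : ℝ≥0 × I → X, Continuous H ∧
    (∀ K : Set X, IsCompact K → IsCompact (H ⁻¹' K)) ∧
    (∀ t, H (t, 0) = c t) ∧ (∀ t, H (t, 1) = c' t)

/-- `X` has exactly one end: it is noncompact and, for every compact `K`, all points
sufficiently far out lie in a single connected component of `X ∖ K`. -/
def HasOneEnd (X : Type*) [MetricSpace X] : Prop :=
  ¬ IsCompact (univ : Set X) ∧
    ∀ K : Set X, IsCompact K → ∃ K' : Set X, IsCompact K' ∧ K ⊆ K' ∧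
      ∀ x ∈ K'ᶜ, ∀ y ∈ K'ᶜ, connectedComponentIn Kᶜ x = connectedComponentIn Kᶜ y

/-- Two geodesic rays are asymptotic (boundedly close). -/
def AsymptoticRays {X : Type*} [MetricSpace X] (γ γ' : GeodesicRay X) : Prop :=
  ∃ C : ℝ, ∀ t, dist (γ.toFun t) (γ'.toFun t) ≤ C

/-- The compactification `X̂ = X ∪ ∂X` of a proper CAT(0) space by its visual boundary with
the cone topology: a compact metrizable space containing `X` as an open dense subspace, whose
boundary points correspond bijectively to asymptoty classes of geodesic rays, each geodesic
ray converging to its point at infinity. -/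
structure BoundaryCompactification (X : Type*) [MetricSpace X] where
  carrier : Type
  [topSpace : TopologicalSpace carrier]
  compactSpace : CompactSpace carrier
  metrizable : TopologicalSpace.MetrizableSpace carrier
  incl : X → carrier
  isEmbedding : Topology.IsEmbedding incl
  dense_range : DenseRange incl
  isOpen_range : IsOpen (range incl)
  endpoint : GeodesicRay X → carrier
  endpoint_not_mem : ∀ γ, endpoint γ ∉ range incl
  tendsto_endpoint : ∀ γ, Tendsto (incl ∘ γ.toFun) atTop (𝓝 (endpoint γ))
  endpoint_eq_iff : ∀ γ γ', endpoint γ = endpoint γ' ↔ AsymptoticRays γ γ'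
  endpoint_surj : ∀ p, p ∉ range incl → ∃ γ, endpoint γ = p

attribute [instance] BoundaryCompactification.topSpace

/-- The visual boundary `∂X`, as a subset of the compactification. -/
def BoundaryCompactification.boundary {X : Type*} [MetricSpace X]
    (B : BoundaryCompactification X) : Set B.carrier :=
  (range B.incl)ᶜ

/-- A ray `c : [0,∞) → X` ends at the point `p ∈ ∂X` if `c` extends continuously to
`[0,∞]` sending `∞` to `p`, i.e. `c` converges to `p` in `X̂`. -/
def BoundaryCompactification.EndsAt {X : Type*} [MetricSpace X]
    (B : BoundaryCompactification X) (c : ℝ≥0 → X) (p : B.carrier) : Prop :=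
  p ∈ B.boundary ∧ Tendsto (B.incl ∘ c) atTop (𝓝 p)

universe u

section Flatness

variable {Z : Type u} [UniformSpace Z]

/-- `E k` holds for all `k` between nearby points of `S` close to `ζ`. -/
def FlatAt (E : ℕ → Z → Z → Prop) (S : Set Z) (ζ : Z) : Prop :=
  ∃ U ∈ 𝓝 ζ, ∀ ξ ∈ U ∩ S, ∀ η ∈ U ∩ S, ∀ k, E k ξ η

/-- The derived set of points at which `S` is not flat. -/
def flatDerived (E : ℕ → Z → Z → Prop) (S : Set Z) : Set Z :=
  {ζ ∈ S | ¬ FlatAt E S ζ}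

/-- The transfinite iteration of `flatDerived`. -/
noncomputable def flatLevel (E : ℕ → Z → Z → Prop) (o : Ordinal.{u}) : Set Z :=
  ⋂ γ : Iio o, flatDerived E (flatLevel E γ.1)
termination_by o
decreasing_by exact γ.2

lemma isOpen_flatAt (E : ℕ → Z → Z → Prop) (S : Set Z) : IsOpen {ζ | FlatAt E S ζ} := by
  rw [isOpen_iff_mem_nhds]
  rintro ζ ⟨U, hU, h⟩
  obtain ⟨V, hVU, hV, hζ⟩ := mem_nhds_iff.1 hU
  exact mem_nhds_iff.2 ⟨V, fun ξ hξ => ⟨U, mem_of_superset (hV.mem_nhds hξ) hVU, h⟩, hV, hζ⟩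

lemma IsClosed.flatDerived {S : Set Z} (hS : IsClosed S) (E : ℕ → Z → Z → Prop) :
    IsClosed (flatDerived E S) :=
  hS.inter (isOpen_flatAt E S).isClosed_compl

lemma flatDerived_subset (E : ℕ → Z → Z → Prop) (S : Set Z) : flatDerived E S ⊆ S :=
  fun _ h => h.1

lemma isClosed_flatLevel (E : ℕ → Z → Z → Prop) (o : Ordinal.{u}) :
    IsClosed (flatLevel E o) := by
  induction o using WellFoundedLT.induction with
  | ind o ih =>
    rw [flatLevel]
    exact isClosed_iInter fun γ => (ih γ.1 γ.2).flatDerived E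

lemma flatLevel_subset_flatDerived (E : ℕ → Z → Z → Prop) {γ o : Ordinal.{u}} (h : γ < o) :
    flatLevel E o ⊆ flatDerived E (flatLevel E γ) := by
  rw [flatLevel]
  exact iInter_subset (fun γ : Iio o => flatDerived E (flatLevel E γ.1)) ⟨γ, h⟩

lemma flatLevel_antitone (E : ℕ → Z → Z → Prop) : Antitone (flatLevel E) := by
  intro γ o h
  rcases h.eq_or_lt with rfl | h
  · exact subset_rfl
  · exact (flatLevel_subset_flatDerived E h).trans (flatDerived_subset E _)

lemma flatLevel_zero (E : ℕ → Z → Z → Prop) : flatLevel E (0 : Ordinal.{u}) = univ := by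
  rw [flatLevel, iInter_eq_univ]
  exact fun γ => absurd γ.2 (not_lt_bot (a := γ.1))

lemma exists_disjoint_flatDerived [CompactSpace Z] (E : ℕ → Z → Z → Prop) {F : Set Z}
    (hF : IsClosed F) {o : Ordinal.{u}} (ho : o ≠ 0) (h : F ∩ flatLevel E o = ∅) :
    ∃ γ < o, F ∩ flatDerived E (flatLevel E γ) = ∅ := by
  rw [flatLevel] at h
  have : Nonempty (Iio o) := ⟨⟨0, pos_iff_ne_zero.2 ho⟩⟩
  obtain ⟨γ, hγ⟩ := hF.isCompact.elim_directed_family_closed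
    (fun γ : Iio o => flatDerived E (flatLevel E γ.1))
    (fun γ => (isClosed_flatLevel E γ.1).flatDerived E) h (by
      have : Antitone (fun γ : Iio o => flatDerived E (flatLevel E γ.1)) := by
        intro a b hab
        rcases hab.eq_or_lt with rfl | hab
        · exact subset_rfl
        · exact (flatDerived_subset E _).trans (flatLevel_subset_flatDerived E hab)
      exact this.directed_ge)
  exact ⟨γ.1, γ.2, hγ⟩

/-- A descending sequence of equivalence-like relations on a compact space, each with
neighbourhoods as classes, whose common refinement has locally countably many classes. -/
structure CountableTower (Z : Type u) [UniformSpace Z] (E : ℕ → Z → Z → Prop)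
    (V₀ : Set (Z × Z)) : Prop where
  mem_uniformity : V₀ ∈ uniformity Z
  refl : ∀ k ξ, E k ξ ξ
  symm : ∀ k ξ η, E k ξ η → E k η ξ
  trans : ∀ k ξ η ζ, (ξ, ζ) ∈ V₀ → E k ξ η → E k η ζ → E k ξ ζ
  anti : ∀ j k ξ η, j ≤ k → E k ξ η → E j ξ η
  loc : ∀ k ζ, ∃ U ∈ 𝓝 ζ, ∀ ξ ∈ U, ∀ η ∈ U, E k ξ η
  count : ∀ ζ, ∃ code : Z → ℕ, ∃ U ∈ 𝓝 ζ, ∀ ξ ∈ U, ∀ η ∈ U, code ξ = code η → ∀ k, E k ξ η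

variable {E : ℕ → Z → Z → Prop} {V₀ : Set (Z × Z)}

lemma exists_nhds_prod_subset {V : Set (Z × Z)} (hV : V ∈ uniformity Z) (ζ : Z) :
    ∃ U, IsOpen U ∧ ζ ∈ U ∧ ∀ ξ ∈ U, ∀ η ∈ U, (ξ, η) ∈ V := by
  have : V ∈ 𝓝 (ζ, ζ) := nhds_le_uniformity ζ hV
  rw [nhds_prod_eq, mem_prod_self_iff] at this
  obtain ⟨U, hU, h⟩ := this
  obtain ⟨W, hWU, hW, hζ⟩ := mem_nhds_iff.1 hU
  exact ⟨W, hW, hζ, fun ξ hξ η hη => h ⟨hWU hξ, hWU hη⟩⟩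

namespace CountableTower

lemma exists_flatAt [CompactSpace Z] [T2Space Z] (h : CountableTower Z E V₀) {S : Set Z}
    (hS : IsClosed S) (hne : S.Nonempty) : ∃ ζ ∈ S, FlatAt E S ζ := by
  obtain ⟨ζ₀, hζ₀⟩ := hne
  obtain ⟨code, U₁, hU₁, hcode⟩ := h.count ζ₀
  obtain ⟨U₂, hU₂, hζU₂, hV₀⟩ := exists_nhds_prod_subset h.mem_uniformity ζ₀
  obtain ⟨U, hUsub, hU, hζU⟩ := mem_nhds_iff.1 (inter_mem hU₁ (hU₂.mem_nhds hζU₂))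
  have : CompactSpace S := isCompact_iff_compactSpace.1 hS.isCompact
  let F : Option ℕ → Set S := fun o => o.elim (Subtype.val ⁻¹' Uᶜ)
    (fun n => closure {ξ : S | ξ.1 ∈ U ∧ code ξ.1 = n})
  have hF : ∀ o, IsClosed (F o) := by
    rintro (_ | n)
    · exact hU.isClosed_compl.preimage continuous_subtype_val
    · exact isClosed_closure
  have hcov : ⋃ o, F o = univ := by
    refine eq_univ_of_forall fun ξ => ?_
    by_cases hξ : ξ.1 ∈ U
    · exact mem_iUnion.2 ⟨some (code ξ.1), subset_closure ⟨hξ, rfl⟩⟩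
    · exact mem_iUnion.2 ⟨none, hξ⟩
  have hd := dense_iUnion_interior_of_closed hF hcov
  obtain ⟨ζ, hζ, hζi⟩ := hd.inter_open_nonempty (Subtype.val ⁻¹' U)
    (hU.preimage continuous_subtype_val) ⟨⟨ζ₀, hζ₀⟩, hζU⟩
  obtain ⟨o, ho⟩ := mem_iUnion.1 hζi
  rcases o with _ | n
  · exact absurd hζ (interior_subset ho)
  obtain ⟨O, hO, hOeq⟩ := isOpen_induced_iff.1 (isOpen_interior (s := F (some n)))
  refine ⟨ζ.1, ζ.2, O ∩ U, (hO.inter hU).mem_nhds ⟨?_, hζ⟩, ?_⟩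
  · have : ζ ∈ Subtype.val ⁻¹' O := hOeq ▸ ho
    exact this
  have key : ∀ ξ ∈ (O ∩ U) ∩ S, ∀ k, ∃ ξ' ∈ U, code ξ' = n ∧ E k ξ ξ' := by
    rintro ξ ⟨⟨hξO, hξU⟩, hξS⟩ k
    have hcl : (⟨ξ, hξS⟩ : S) ∈ closure {ξ : S | ξ.1 ∈ U ∧ code ξ.1 = n} := by
      have : (⟨ξ, hξS⟩ : S) ∈ interior (F (some n)) := hOeq ▸ hξO
      exact interior_subset this
    obtain ⟨N, hN, hE⟩ := h.loc k ξ
    obtain ⟨ξ', hξ'N, hξ'U, hξ'⟩ := mem_closure_iff_nhds.1 hcl _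
      (continuous_subtype_val.continuousAt.preimage_mem_nhds hN)
    exact ⟨ξ', hξ'U, hξ', hE _ (mem_of_mem_nhds hN) _ hξ'N⟩
  intro ξ hξ η hη k
  obtain ⟨ξ', hξ'U, hξ', hEξ⟩ := key ξ hξ k
  obtain ⟨η', hη'U, hη', hEη⟩ := key η hη k
  have hUV : ∀ a ∈ U, ∀ b ∈ U, (a, b) ∈ V₀ := fun a ha b hb =>
    hV₀ _ (hUsub ha).2 _ (hUsub hb).2
  have h1 := hcode _ (hUsub hξ'U).1 _ (hUsub hη'U).1 (hξ'.trans hη'.symm) k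
  exact h.trans k _ _ _ (hUV _ hξ.1.2 _ hη.1.2)
    (h.trans k _ _ _ (hUV _ hξ.1.2 _ hη'U) hEξ h1) (h.symm _ _ _ hEη)

lemma exists_flatLevel_eq_empty [CompactSpace Z] [T2Space Z] (h : CountableTower Z E V₀) :
    ∃ o : Ordinal.{u}, flatLevel E o = ∅ := by
  by_contra! hne
  choose f hf hflat using fun o => h.exists_flatAt (isClosed_flatLevel E o) (hne o)
  refine not_injective_of_ordinal f fun a b hab => ?_
  by_contra hne'
  wlog hlt : a < b generalizing a b
  · exact this b a hab.symm (Ne.symm hne') (lt_of_le_of_ne (not_lt.1 hlt) (Ne.symm hne'))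
  have := flatLevel_subset_flatDerived E hlt (hf b)
  exact this.2 (hab ▸ hflat a)

lemma exists_top [CompactSpace Z] [T2Space Z] (h : CountableTower Z E V₀) {A : Set Z}
    (hA : IsClosed A) (hne : A.Nonempty) :
    ∃ β : Ordinal.{u}, (A ∩ flatLevel E β).Nonempty ∧
      A ∩ flatDerived E (flatLevel E β) = ∅ := by
  obtain ⟨o₁, ho₁⟩ := h.exists_flatLevel_eq_empty
  let s : Set Ordinal.{u} := {o | A ∩ flatLevel E o = ∅}
  have hs : s.Nonempty := ⟨o₁, by simp [s, ho₁]⟩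
  let o := WellFounded.min (wellFounded_lt (α := Ordinal.{u})) s hs
  have ho : A ∩ flatLevel E o = ∅ := WellFounded.min_mem _ s hs
  have ho0 : o ≠ 0 := by
    intro h0
    rw [h0, flatLevel_zero, inter_univ] at ho
    exact hne.ne_empty ho
  obtain ⟨β, hβ, hdis⟩ := exists_disjoint_flatDerived E hA ho0 ho
  refine ⟨β, ?_, hdis⟩
  rw [nonempty_iff_ne_empty]
  exact fun h' => WellFounded.not_lt_min (wellFounded_lt (α := Ordinal.{u})) s h' hβ

/-- An isolated piece `A` of level exactly `β`. -/
def IsolatedLevel (E : ℕ → Z → Z → Prop) (β : Ordinal.{u}) : Prop :=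
  ∃ A O : Set Z, IsClosed A ∧ IsOpen O ∧ O ⊆ A ∧ (A ∩ flatLevel E β).Nonempty ∧
    A ∩ flatDerived E (flatLevel E β) = ∅ ∧ (A \ O) ∩ flatLevel E β = ∅

lemma exists_isolatedLevel_lt [CompactSpace Z] [T2Space Z] (h : CountableTower Z E V₀)
    {β : Ordinal.{u}} (hβ : IsolatedLevel E β) (h0 : β ≠ 0) :
    ∃ β' < β, IsolatedLevel E β' := by
  obtain ⟨A, O, hA, hO, hOA, hne, hder, hiso⟩ := hβ
  set L := A ∩ flatLevel E β with hL
  have hLcl : IsClosed L := hA.inter (isClosed_flatLevel E β)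
  have hLO : L ⊆ O := by
    intro ζ hζ
    by_contra hζO
    exact (hiso ▸ (⟨⟨hζ.1, hζO⟩, hζ.2⟩ : ζ ∈ (A \ O) ∩ flatLevel E β) : ζ ∈ (∅ : Set Z))
  have hflat : ∀ ζ ∈ L, FlatAt E (flatLevel E β) ζ := by
    intro ζ hζ
    by_contra hn
    exact (hder ▸ (⟨hζ.1, hζ.2, hn⟩ : ζ ∈ A ∩ flatDerived E (flatLevel E β)) :
      ζ ∈ (∅ : Set Z))
  obtain ⟨V, hV, hVE⟩ : ∃ V ∈ uniformity Z, ∀ ζ ∈ L, ∀ ζ' ∈ flatLevel E β, (ζ, ζ') ∈ V →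
      ∀ k, E k ζ ζ' := by
    choose U hU hUE using hflat
    obtain ⟨V, hV, hV'⟩ := lebesgue_number_lemma_nhds' hLcl.isCompact hU
    refine ⟨V, hV, fun ζ hζ ζ' hζ' hmem k => ?_⟩
    obtain ⟨y, hy⟩ := hV' ζ hζ
    exact hUE y y.2 ζ ⟨hy (mem_of_mem_nhds (UniformSpace.ball_mem_nhds ζ hV)), hζ.2⟩ ζ'
      ⟨hy hmem, hζ'⟩ k
  obtain ⟨V₂, hV₂, hV₂sub⟩ := comp_mem_uniformity_sets (inter_mem hV h.mem_uniformity)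
  obtain ⟨V₁, hV₁, hV₁o, hV₁s, hV₁sub⟩ := comp_open_symm_mem_uniformity_sets hV₂
  have hV₁V₂ : ∀ {a b}, (a, b) ∈ V₁ → (a, b) ∈ V₂ := fun {a b} hab =>
    hV₁sub ⟨a, refl_mem_uniformity hV₁, hab⟩
  have hV₂V : ∀ {a b}, (a, b) ∈ V₂ → (a, b) ∈ V ∩ V₀ := fun {a b} hab =>
    hV₂sub ⟨a, refl_mem_uniformity hV₂, hab⟩
  have hs : ∀ {a b}, (a, b) ∈ V₁ → (b, a) ∈ V₁ := fun {a b} hab => hV₁s.symm a b hab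
  have h4 : ∀ {a b c d e}, (a, b) ∈ V₁ → (b, c) ∈ V₁ → (c, d) ∈ V₁ → (d, e) ∈ V₁ →
      (a, e) ∈ V ∩ V₀ := fun {a b c d e} h1 h2 h3 h4 =>
    hV₂sub ⟨c, hV₁sub ⟨b, h1, h2⟩, hV₁sub ⟨d, h3, h4⟩⟩
  have hr : ∀ a, (a, a) ∈ V₁ := fun a => refl_mem_uniformity hV₁
  obtain ⟨N, hNc, hLN, hNsub⟩ := exists_compact_between hLcl.isCompact
    (hO.inter (isOpen_biUnion (s := L) fun ζ _ => UniformSpace.isOpen_ball ζ hV₁o))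
    (subset_inter hLO fun ζ hζ => mem_biUnion hζ (hr ζ))
  have hNL : ∀ ξ ∈ N, ∃ ζ ∈ L, (ζ, ξ) ∈ V₁ := fun ξ hξ => by
    obtain ⟨ζ, hζ, h'⟩ := mem_iUnion₂.1 (hNsub hξ).2
    exact ⟨ζ, hζ, h'⟩
  have hNO : N ⊆ O := fun ξ hξ => (hNsub hξ).1
  have hNcl : IsClosed N := hNc.isClosed
  let T : ℕ → Set Z := fun k => {ξ ∈ N | ∃ ζ ∈ L, (ζ, ξ) ∈ V₁ ∧ E k ζ ξ}
  have hstep : ∀ k ξ ξ', ξ' ∈ N → (ξ, ξ') ∈ V₁ → E k ξ ξ' → ξ ∈ T k → ξ' ∈ T k := by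
    rintro k ξ ξ' hξ' hmem hE ⟨hξ, ζ, hζ, hζξ, hEζ⟩
    obtain ⟨ζ', hζ', hζξ'⟩ := hNL ξ' hξ'
    refine ⟨hξ', ζ', hζ', hζξ', ?_⟩
    have h1 := hVE ζ hζ ζ' hζ'.2 (h4 hζξ hmem (hs hζξ') (hr _)).1 k
    refine h.trans k _ _ _ (h4 hζξ' (hr _) (hr _) (hr _)).2 ?_ hE
    exact h.trans k _ _ _ (h4 hζξ' (hs hmem) (hr _) (hr _)).2 (h.symm _ _ _ h1) hEζ
  have hLT : ∀ k, L ⊆ T k := fun k ζ hζ =>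
    ⟨interior_subset (hLN hζ), ζ, hζ, hr ζ, h.refl k ζ⟩
  have hTanti : ∀ {j k}, j ≤ k → T k ⊆ T j := by
    rintro j k hjk ξ ⟨hξ, ζ, hζ, hmem, hE⟩
    exact ⟨hξ, ζ, hζ, hmem, h.anti j k _ _ hjk hE⟩
  have hnear : ∀ k ξ, ∃ U ∈ 𝓝 ξ, ∀ a ∈ U, ∀ b ∈ U, b ∈ N → a ∈ T k → b ∈ T k := by
    intro k ξ
    obtain ⟨U, hU, hUE⟩ := h.loc k ξ
    obtain ⟨U', hU'o, hξU', hU'V⟩ := exists_nhds_prod_subset hV₁ ξ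
    exact ⟨U ∩ U', inter_mem hU (hU'o.mem_nhds hξU'), fun a ha b hb hbN =>
      hstep k a b hbN (hU'V a ha.2 b hb.2) (hUE a ha.1 b hb.1)⟩
  have hTcl : ∀ k, IsClosed (T k) := by
    refine fun k => isClosed_of_closure_subset fun ξ hξ => ?_
    have hξN : ξ ∈ N := hNcl.closure_subset_iff.2 (fun a ha => ha.1) hξ
    obtain ⟨U, hU, hUT⟩ := hnear k ξ
    obtain ⟨a, haU, haT⟩ := mem_closure_iff_nhds.1 hξ U hU
    exact hUT a haU ξ (mem_of_mem_nhds hU) hξN haT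
  have hNTcl : ∀ k, IsClosed (N \ T k) := by
    refine fun k => isClosed_of_closure_subset fun ξ hξ => ?_
    have hξN : ξ ∈ N := hNcl.closure_subset_iff.2 (fun a ha => ha.1) hξ
    obtain ⟨U, hU, hUT⟩ := hnear k ξ
    obtain ⟨a, haU, haN, haT⟩ := mem_closure_iff_nhds.1 hξ U hU
    exact ⟨hξN, fun hξT => haT (hUT ξ (mem_of_mem_nhds hU) a haU haN hξT)⟩
  have hTo : ∀ k, IsOpen (T k ∩ interior N) := by
    intro k
    have : T k ∩ interior N = (N \ T k)ᶜ ∩ interior N := by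
      ext ξ
      refine ⟨fun hξ => ⟨fun h' => h'.2 hξ.1, hξ.2⟩, fun hξ => ⟨?_, hξ.2⟩⟩
      by_contra hT
      exact hξ.1 ⟨interior_subset hξ.2, hT⟩
    rw [this]
    exact (hNTcl k).isOpen_compl.inter isOpen_interior
  let D : ℕ → Set Z := fun k => T k \ T (k + 1)
  have hDeq : ∀ k, D k = T k ∩ (N \ T (k + 1)) := fun k => by
    ext ξ
    exact ⟨fun hξ => ⟨hξ.1, hξ.1.1, hξ.2⟩, fun hξ => ⟨hξ.1, hξ.2.2⟩⟩
  have hDcl : ∀ k, IsClosed (D k) := fun k => hDeq k ▸ (hTcl k).inter (hNTcl (k + 1))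
  have hDo : ∀ k, IsOpen (D k ∩ interior N) := fun k => by
    have : D k ∩ interior N = (T k ∩ interior N) ∩ (T (k + 1))ᶜ := by
      ext ξ
      simp only [D, mem_inter_iff, Set.mem_sdiff, mem_compl_iff]
      tauto
    rw [this]
    exact (hTo k).inter (hTcl _).isOpen_compl
  have hDβ : ∀ k, D k ∩ flatLevel E β = ∅ := by
    refine fun k => eq_empty_of_forall_notMem fun ξ hξ => ?_
    exact hξ.1.2 (hLT _ ⟨hOA (hNO hξ.1.1.1), hξ.2⟩)
  obtain ⟨γ, hγβ, hγ⟩ := exists_disjoint_flatDerived E (hNcl.sdiff isOpen_interior) h0 (by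
    refine eq_empty_of_forall_notMem fun ξ hξ => ?_
    exact hξ.1.2 (hLN ⟨hOA (hNO hξ.1.1), hξ.2⟩))
  have claim1 : ∃ k₀, ∀ k ≥ k₀, ∀ ξ ∈ (N \ interior N) ∩ flatLevel E γ, ξ ∉ D k := by
    have hc : IsCompact ((N \ interior N) ∩ flatLevel E γ) :=
      ((hNcl.sdiff isOpen_interior).inter (isClosed_flatLevel E γ)).isCompact
    refine hc.induction_on (p := fun s => ∃ k₀, ∀ k ≥ k₀, ∀ ξ ∈ s, ξ ∉ D k) ⟨0, by simp⟩
      (fun s t hst ⟨k₀, hk⟩ => ⟨k₀, fun k hk' ξ hξ => hk k hk' ξ (hst hξ)⟩)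
      (fun s t ⟨j, hj⟩ ⟨k, hk⟩ => ⟨max j k, fun i hi ξ hξ => ?_⟩) ?_
    · rcases hξ with hξ | hξ
      · exact hj i (le_of_max_le_left hi) ξ hξ
      · exact hk i (le_of_max_le_right hi) ξ hξ
    · intro ξ hξ
      have hfl : FlatAt E (flatLevel E γ) ξ := by
        by_contra hn
        exact (hγ ▸ (⟨hξ.1, hξ.2, hn⟩ :
          ξ ∈ (N \ interior N) ∩ flatDerived E (flatLevel E γ)) : ξ ∈ (∅ : Set Z))
      obtain ⟨U, hU, hUE⟩ := hfl
      obtain ⟨U', hU'o, hξU', hU'V⟩ := exists_nhds_prod_subset hV₁ ξ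
      refine ⟨(U ∩ U') ∩ ((N \ interior N) ∩ flatLevel E γ),
        inter_mem (mem_nhdsWithin_of_mem_nhds (inter_mem hU (hU'o.mem_nhds hξU')))
          self_mem_nhdsWithin, ?_⟩
      have hall : ∀ k, ∀ a ∈ (U ∩ U') ∩ flatLevel E γ, ∀ b ∈ (U ∩ U') ∩ flatLevel E γ, b ∈ N →
          a ∈ T k → b ∈ T k := fun k a ha b hb hbN =>
        hstep k a b hbN (hU'V a ha.1.2 b hb.1.2) (hUE a ⟨ha.1.1, ha.2⟩ b ⟨hb.1.1, hb.2⟩ k)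
      have hξm : ξ ∈ (U ∩ U') ∩ flatLevel E γ := ⟨⟨mem_of_mem_nhds hU, hξU'⟩, hξ.2⟩
      by_cases hT : ∀ k, ξ ∈ T k
      · exact ⟨0, fun k _ a ha haD =>
          haD.2 (hall (k + 1) ξ hξm a ⟨ha.1, ha.2.2⟩ ha.2.1.1 (hT _))⟩
      · push Not at hT
        obtain ⟨k₁, hk₁⟩ := hT
        exact ⟨k₁, fun k hk a ha haD =>
          hk₁ (hTanti hk (hall k a ⟨ha.1, ha.2.2⟩ ξ hξm hξ.1.1 haD.1))⟩
  have claim2 : ∀ k₀, ∃ k ≥ k₀, (D k ∩ flatLevel E γ).Nonempty := by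
    intro k₀
    by_contra! hno
    have hTall : ∀ k, ∀ ξ ∈ T k₀ ∩ flatLevel E γ, ξ ∈ T k := by
      intro k ξ hξ
      rcases le_total k k₀ with hk | hk
      · exact hTanti hk hξ.1
      · induction k, hk using Nat.le_induction with
        | base => exact hξ.1
        | succ k hk ih =>
          by_contra hn
          exact (hno k hk ▸ (⟨⟨ih, hn⟩, hξ.2⟩ : ξ ∈ D k ∩ flatLevel E γ) : ξ ∈ (∅ : Set Z))
    obtain ⟨ζ, hζ⟩ := hne
    have hζγ := flatLevel_subset_flatDerived E hγβ hζ.2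
    refine hζγ.2 ⟨(T k₀ ∩ interior N) ∩ UniformSpace.ball ζ V₁,
      ((hTo k₀).inter (UniformSpace.isOpen_ball ζ hV₁o)).mem_nhds
        ⟨⟨hLT _ hζ, hLN hζ⟩, hr ζ⟩, ?_⟩
    rintro ξ ⟨⟨⟨hξT, -⟩, hξζ⟩, hξγ⟩ η ⟨⟨⟨hηT, -⟩, hηζ⟩, hηγ⟩ k
    obtain ⟨-, ζ₁, hζ₁, hζ₁ξ, hE₁⟩ := hTall k ξ ⟨hξT, hξγ⟩
    obtain ⟨-, ζ₂, hζ₂, hζ₂η, hE₂⟩ := hTall k η ⟨hηT, hηγ⟩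
    have hmid := hVE ζ₁ hζ₁ ζ₂ hζ₂.2 (h4 hζ₁ξ (hs hξζ) hηζ (hs hζ₂η)).1 k
    refine h.trans k _ _ _ (h4 (hs hξζ) hηζ (hr _) (hr _)).2 (h.symm _ _ _ hE₁) ?_
    exact h.trans k _ _ _ (h4 hζ₁ξ (hs hξζ) hηζ (hr _)).2 hmid hE₂
  obtain ⟨k₀, hk₀⟩ := claim1
  obtain ⟨k, hk, hkne⟩ := claim2 k₀
  obtain ⟨β', hβ'ne, hβ'der⟩ := h.exists_top (hDcl k) (hkne.mono inter_subset_left)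
  refine ⟨β', ?_, D k, D k ∩ interior N, hDcl k, hDo k, inter_subset_left, hβ'ne, hβ'der, ?_⟩
  · by_contra hlt
    have := hβ'ne.mono (inter_subset_inter_right (D k) (flatLevel_antitone E (not_lt.1 hlt)))
    exact this.ne_empty (hDβ k)
  · have hγβ' : γ ≤ β' := by
      by_contra hlt
      have := hkne.mono (inter_subset_inter_right (D k)
        (flatLevel_subset_flatDerived E (not_le.1 hlt)))
      exact this.ne_empty hβ'der
    refine eq_empty_of_forall_notMem fun ξ hξ => ?_
    exact hk₀ k hk ξ ⟨⟨hξ.1.1.1.1, fun hi => hξ.1.2 ⟨hξ.1.1, hi⟩⟩,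
      flatLevel_antitone E hγβ' hξ.2⟩ hξ.1.1

/-- On a connected compact space every point is flat for a countable tower. -/
theorem flatAt_univ [CompactSpace Z] [T2Space Z] [PreconnectedSpace Z]
    (h : CountableTower Z E V₀) (ζ : Z) :
    ∃ U ∈ 𝓝 ζ, ∀ ξ ∈ U, ∀ η ∈ U, ∀ k, E k ξ η := by
  obtain ⟨β₀, hβ₀, hβ₀'⟩ := h.exists_top isClosed_univ ⟨ζ, mem_univ _⟩
  have hzero : IsolatedLevel E (0 : Ordinal.{u}) := by
    have hP : IsolatedLevel E β₀ :=
      ⟨univ, univ, isClosed_univ, isOpen_univ, subset_rfl, hβ₀, hβ₀', by simp⟩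
    clear hβ₀ hβ₀'
    induction β₀ using WellFoundedLT.induction with
    | ind o ih =>
      by_cases ho : o = 0
      · exact ho ▸ hP
      · obtain ⟨β', hlt, h'⟩ := h.exists_isolatedLevel_lt hP ho
        exact ih β' hlt h'
  obtain ⟨A, O, hA, hO, hOA, hne, hder, hiso⟩ := hzero
  rw [flatLevel_zero, inter_univ] at hne hiso
  rw [flatLevel_zero] at hder
  have hAO : A = O := (sdiff_eq_empty.1 hiso).antisymm hOA
  have hAu : A = univ := IsClopen.eq_univ ⟨hA, hAO ▸ hO⟩ hne
  rw [hAu, univ_inter] at hder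
  have : FlatAt E univ ζ := by
    by_contra hn
    exact (hder ▸ (⟨mem_univ _, hn⟩ : ζ ∈ flatDerived E univ) : ζ ∈ (∅ : Set Z))
  obtain ⟨U, hU, hUE⟩ := this
  exact ⟨U, hU, fun ξ hξ η hη => hUE ξ ⟨hξ, mem_univ _⟩ η ⟨hη, mem_univ _⟩⟩

end CountableTower
end Flatness

section Bicombing

lemma nonpos_of_midpoint_convex {g : ℝ → ℝ} (hg : ContinuousOn g (Icc 0 1))
    (h : ∀ s ∈ Icc (0 : ℝ) 1, ∀ t ∈ Icc (0 : ℝ) 1, g ((s + t) / 2) ≤ (g s + g t) / 2)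
    (h0 : g 0 ≤ 0) (h1 : g 1 ≤ 0) {t : ℝ} (ht : t ∈ Icc (0 : ℝ) 1) : g t ≤ 0 := by
  obtain ⟨b, hb, hmax⟩ := isCompact_Icc.exists_isMaxOn (nonempty_Icc.2 zero_le_one) hg
  by_contra! hpos
  have hgb : 0 < g b := hpos.trans_le (hmax ht)
  have hclosed : IsClosed (Icc (0 : ℝ) 1 ∩ g ⁻¹' {g b}) :=
    hg.preimage_isClosed_of_isClosed isClosed_Icc isClosed_singleton
  have hc : IsCompact (Icc (0 : ℝ) 1 ∩ g ⁻¹' {g b}) :=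
    isCompact_Icc.of_isClosed_subset hclosed inter_subset_left
  obtain ⟨a, ⟨ha, hga⟩, hleast⟩ := hc.exists_isLeast ⟨b, hb, rfl⟩
  have hga : g a = g b := hga
  have ha0 : 0 < a := lt_of_le_of_ne ha.1 (fun h' => by rw [← h'] at hga; linarith)
  have ha1 : a < 1 := lt_of_le_of_ne ha.2 (fun h' => by rw [h'] at hga; linarith)
  set d := min a (1 - a) with hd
  have hd0 : 0 < d := lt_min ha0 (by linarith)
  have hd1 : d ≤ a := min_le_left _ _
  have hd2 : d ≤ 1 - a := min_le_right _ _
  have hm : a - d ∈ Icc (0 : ℝ) 1 := ⟨by linarith, by linarith⟩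
  have hp : a + d ∈ Icc (0 : ℝ) 1 := ⟨by linarith, by linarith⟩
  have hmid := h _ hm _ hp
  rw [show (a - d + (a + d)) / 2 = a by ring] at hmid
  have hm' : g (a - d) ≤ g b := hmax hm
  have hp' : g (a + d) ≤ g b := hmax hp
  have : a ≤ a - d := hleast ⟨hm, show g (a - d) = g b by linarith⟩
  linarith

variable {X : Type u} [MetricSpace X]

/-- `γ` is a geodesic from `x` to `y`, parametrized proportionally to arc length on `[0,1]`. -/
def AffineGeodesic (γ : ℝ → X) (x y : X) : Prop :=
  γ 0 = x ∧ γ 1 = y ∧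
    ∀ s ∈ Icc (0 : ℝ) 1, ∀ t ∈ Icc (0 : ℝ) 1, dist (γ s) (γ t) = |s - t| * dist x y

lemma AffineGeodesic.continuousOn {γ : ℝ → X} {x y : X} (h : AffineGeodesic γ x y) :
    ContinuousOn γ (Icc 0 1) := by
  refine (LipschitzOnWith.of_dist_le_mul (K := ⟨dist x y, dist_nonneg⟩)
    fun s hs t ht => ?_).continuousOn
  rw [h.2.2 s hs t ht, Real.dist_eq, mul_comm]
  rfl

lemma AffineGeodesic.midpoint {γ : ℝ → X} {x y : X} (h : AffineGeodesic γ x y) {s t : ℝ}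
    (hs : s ∈ Icc (0 : ℝ) 1) (ht : t ∈ Icc (0 : ℝ) 1) :
    dist (γ s) (γ ((s + t) / 2)) = dist (γ s) (γ t) / 2 := by
  have hm : (s + t) / 2 ∈ Icc (0 : ℝ) 1 :=
    ⟨by linarith [hs.1, ht.1], by linarith [hs.2, ht.2]⟩
  rw [h.2.2 s hs _ hm, h.2.2 s hs t ht, show s - (s + t) / 2 = (s - t) / 2 by ring, abs_div]
  norm_num
  ring

variable [hX : Fact (IsCAT0Space X)]

lemma exists_affineGeodesic (x y : X) : ∃ γ : ℝ → X, AffineGeodesic γ x y := by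
  obtain ⟨γ, h0, h1, h⟩ := hX.out.1 x y
  have hmem : ∀ s ∈ Icc (0 : ℝ) 1, s * dist x y ∈ Icc 0 (dist x y) := fun s hs =>
    ⟨mul_nonneg hs.1 dist_nonneg, mul_le_of_le_one_left dist_nonneg hs.2⟩
  refine ⟨fun t => γ (t * dist x y), by simpa, by simpa, fun s hs t ht => ?_⟩
  rw [h _ (hmem s hs) _ (hmem t ht), ← sub_mul, abs_mul, abs_of_nonneg dist_nonneg]

lemma dist_midpoints_le {x y z m m' : X} (h1 : dist x m = dist x y / 2)
    (h2 : dist y m = dist x y / 2) (h3 : dist x m' = dist x z / 2)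
    (h4 : dist z m' = dist x z / 2) : dist m m' ≤ dist y z / 2 := by
  have a := hX.out.2 x z m' m h3 h4
  have b := hX.out.2 x y m z h1 h2
  rw [dist_comm m x, h1, dist_comm m z] at a
  rw [dist_comm z x, dist_comm z y] at b
  refine abs_le_of_sq_le_sq' ?_ (by positivity) |>.2
  nlinarith

lemma AffineGeodesic.dist_le {γ γ' : ℝ → X} {x y x' y' : X} (h : AffineGeodesic γ x y)
    (h' : AffineGeodesic γ' x' y') {t : ℝ} (ht : t ∈ Icc (0 : ℝ) 1) :
    dist (γ t) (γ' t) ≤ (1 - t) * dist x x' + t * dist y y' := by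
  have key := nonpos_of_midpoint_convex
    (g := fun t => dist (γ t) (γ' t) - ((1 - t) * dist x x' + t * dist y y'))
    ((continuous_dist.comp_continuousOn (h.continuousOn.prodMk h'.continuousOn)).sub
      (by fun_prop)) ?_ ?_ ?_ ht
  · linarith
  · intro s hs t ht
    obtain ⟨δ, hδ⟩ := exists_affineGeodesic (γ s) (γ' t)
    have h0 : (0 : ℝ) ∈ Icc (0 : ℝ) 1 := ⟨le_rfl, zero_le_one⟩
    have h1 : (1 : ℝ) ∈ Icc (0 : ℝ) 1 := ⟨zero_le_one, le_rfl⟩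
    have e1 := hδ.midpoint h0 h1
    have e2 := hδ.midpoint h1 h0
    rw [hδ.1, hδ.2.1] at e1 e2
    rw [add_comm 1 0] at e2
    have g1 := h.midpoint hs ht
    have g2 := h.midpoint ht hs
    have g3 := h'.midpoint hs ht
    have g4 := h'.midpoint ht hs
    rw [add_comm t s] at g2 g4
    have d1 := dist_midpoints_le g1 (by rw [g2, dist_comm]) e1 (by rw [e2, dist_comm])
    have d2 := dist_midpoints_le (x := γ' t) (y := γ s) (z := γ' s) e2 (by rw [e1, dist_comm])
      g4 (by rw [g3, dist_comm])
    have := dist_triangle (γ ((s + t) / 2)) (δ ((0 + 1) / 2)) (γ' ((s + t) / 2))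
    linarith
  · simp [h.1, h'.1]
  · simp [h.2.1, h'.2.1]

/-- The geodesic from `x` to `y`, constant outside `[0,1]`. -/
noncomputable def geo (x y : X) (t : ℝ) : X :=
  (exists_affineGeodesic x y).choose (projIcc 0 1 zero_le_one t)

lemma geo_affineGeodesic (x y : X) : AffineGeodesic (geo x y) x y := by
  have h := (exists_affineGeodesic x y).choose_spec
  refine ⟨by simpa [geo] using h.1, by simpa [geo] using h.2.1, fun s hs t ht => ?_⟩
  rw [geo, geo, projIcc_of_mem _ hs, projIcc_of_mem _ ht]
  exact h.2.2 s hs t ht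

lemma AffineGeodesic.eq_geo {γ : ℝ → X} {x y : X} (h : AffineGeodesic γ x y) {t : ℝ}
    (ht : t ∈ Icc (0 : ℝ) 1) : γ t = geo x y t := by
  have := h.dist_le (geo_affineGeodesic x y) ht
  simp only [dist_self, mul_zero, add_zero] at this
  exact dist_le_zero.1 this

@[simp] lemma geo_zero (x y : X) : geo x y 0 = x := (geo_affineGeodesic x y).1

@[simp] lemma geo_one (x y : X) : geo x y 1 = y := (geo_affineGeodesic x y).2.1

lemma geo_projIcc (x y : X) (t : ℝ) : geo x y (projIcc 0 1 zero_le_one t) = geo x y t := by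
  simp [geo]

@[simp] lemma geo_self (x : X) (t : ℝ) : geo x x t = x := by
  rw [← geo_projIcc]
  have := (geo_affineGeodesic x x).2.2 _ (projIcc (0 : ℝ) 1 zero_le_one t).2 0 ⟨le_rfl, zero_le_one⟩
  simpa using this

lemma dist_geo_geo_le (x y x' y' : X) (t : ℝ) :
    dist (geo x y t) (geo x' y' t) ≤ dist x x' + dist y y' := by
  rw [← geo_projIcc, ← geo_projIcc x']
  have ht := (projIcc (0 : ℝ) 1 zero_le_one t).2
  refine ((geo_affineGeodesic x y).dist_le (geo_affineGeodesic x' y') ht).trans ?_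
  nlinarith [ht.1, ht.2, dist_nonneg (x := x) (y := x'), dist_nonneg (x := y) (y := y')]

lemma dist_left_geo (x y : X) {t : ℝ} (ht : t ∈ Icc (0 : ℝ) 1) :
    dist x (geo x y t) = t * dist x y := by
  have := (geo_affineGeodesic x y).2.2 0 ⟨le_rfl, zero_le_one⟩ t ht
  rwa [geo_zero, zero_sub, abs_neg, abs_of_nonneg ht.1] at this

lemma continuous_geo : Continuous fun p : X × X × ℝ => geo p.1 p.2.1 p.2.2 := by
  have hline : ∀ x y : X, Continuous (geo x y) := fun x y => by
    have : geo x y = fun t => geo x y (projIcc (0 : ℝ) 1 zero_le_one t) := by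
      ext t; rw [geo_projIcc]
    rw [this]
    exact ((geo_affineGeodesic x y).continuousOn.comp_continuous
      (continuous_subtype_val.comp continuous_projIcc) fun t => (projIcc _ _ _ t).2)
  rw [continuous_iff_continuousAt]
  rintro ⟨x, y, t⟩
  rw [ContinuousAt, tendsto_iff_dist_tendsto_zero]
  have hb : Tendsto (fun p : X × X × ℝ => (dist p.1 x + dist p.2.1 y) +
      dist (geo x y p.2.2) (geo x y t)) (𝓝 (x, y, t)) (𝓝 0) := by
    have : Continuous (fun p : X × X × ℝ => (dist p.1 x + dist p.2.1 y) +
      dist (geo x y p.2.2) (geo x y t)) := by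
      have := (hline x y).comp (continuous_snd.comp (continuous_snd (X := X) (Y := X × ℝ)))
      fun_prop
    simpa using this.tendsto (x, y, t)
  refine squeeze_zero (fun _ => dist_nonneg) (fun p => ?_) hb
  exact (dist_triangle _ (geo x y p.2.2) _).trans
    (add_le_add_left (dist_geo_geo_le _ _ _ _ _) _)

lemma Continuous.geo {T : Type*} [TopologicalSpace T] {f g : T → X} {h : T → ℝ}
    (hf : Continuous f) (hg : Continuous g) (hh : Continuous h) :
    Continuous fun t => geo (f t) (g t) (h t) :=
  continuous_geo.comp (hf.prodMk (hg.prodMk hh))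

/-- The point at distance `min s (dist x₀ x)` from `x₀` on the geodesic from `x₀` to `x`. -/
noncomputable def proj (x₀ x : X) (s : ℝ) : X := geo x₀ x (s / dist x₀ x)

variable {x₀ : X}

lemma Continuous.proj {T : Type*} [TopologicalSpace T] {f : T → X} {h : T → ℝ}
    (hf : Continuous f) (hh : Continuous h) (h0 : ∀ t, 0 < dist x₀ (f t)) :
    Continuous fun t => proj x₀ (f t) (h t) :=
  continuous_const.geo hf (hh.div (continuous_const.dist hf) fun t => (h0 t).ne')

lemma dist_proj {x : X} {s : ℝ} (hs : 0 ≤ s) (hsx : s ≤ dist x₀ x) :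
    dist x₀ (proj x₀ x s) = s := by
  rcases (dist_nonneg (x := x₀) (y := x)).eq_or_lt with h | h
  · have : s = 0 := by linarith
    rw [proj, ← h, div_zero, geo_zero, dist_self, this]
  · rw [proj, dist_left_geo _ _ ⟨div_nonneg hs h.le, (div_le_one h).2 hsx⟩, div_mul_cancel₀ _ h.ne']

lemma proj_self (x : X) : proj x₀ x (dist x₀ x) = x := by
  rcases (dist_nonneg (x := x₀) (y := x)).eq_or_lt with h | h
  · rw [proj, ← h, div_zero, geo_zero]
    exact dist_eq_zero.1 h.symm
  · rw [proj, div_self h.ne', geo_one]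

lemma eq_proj_of_isometry {c : ℝ → X} {ℓ : ℝ} (h0 : c 0 = x₀)
    (hc : ∀ s ∈ Icc (0 : ℝ) ℓ, ∀ t ∈ Icc (0 : ℝ) ℓ, dist (c s) (c t) = |s - t|) {s : ℝ}
    (hs : s ∈ Icc (0 : ℝ) ℓ) : c s = proj x₀ (c ℓ) s := by
  have hℓ : 0 ≤ ℓ := hs.1.trans hs.2
  have hd : dist x₀ (c ℓ) = ℓ := by
    rw [← h0, hc 0 ⟨le_rfl, hℓ⟩ ℓ ⟨hℓ, le_rfl⟩, zero_sub, abs_neg, abs_of_nonneg hℓ]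
  rcases hℓ.eq_or_lt with h | h
  · have : s = 0 := by linarith [hs.1, hs.2]
    rw [proj, this, zero_div, geo_zero, h0]
  have hmem : ∀ u ∈ Icc (0 : ℝ) 1, u * ℓ ∈ Icc 0 ℓ := fun u hu =>
    ⟨mul_nonneg hu.1 hℓ, mul_le_of_le_one_left hℓ hu.2⟩
  have hA : AffineGeodesic (fun u => c (u * ℓ)) x₀ (c ℓ) :=
    ⟨by simpa, by simp, fun u hu v hv => by
      rw [hc _ (hmem u hu) _ (hmem v hv), ← sub_mul, abs_mul, abs_of_nonneg hℓ, hd]⟩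
  have := hA.eq_geo (t := s / ℓ) ⟨div_nonneg hs.1 hℓ, (div_le_one h).2 hs.2⟩
  simpa [proj, hd, div_mul_cancel₀ _ h.ne'] using this

lemma dist_proj_proj_self {x : X} {s t : ℝ} (hs : s ∈ Icc 0 (dist x₀ x))
    (ht : t ∈ Icc 0 (dist x₀ x)) : dist (proj x₀ x s) (proj x₀ x t) = |s - t| := by
  rcases (dist_nonneg (x := x₀) (y := x)).eq_or_lt with h | h
  · have h1 : s = 0 := by linarith [hs.1, hs.2]
    have h2 : t = 0 := by linarith [ht.1, ht.2]
    simp [h1, h2]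
  · rw [proj, proj, (geo_affineGeodesic x₀ x).2.2 _ ⟨div_nonneg hs.1 h.le, (div_le_one h).2 hs.2⟩ _
      ⟨div_nonneg ht.1 h.le, (div_le_one h).2 ht.2⟩, ← sub_div, abs_div, abs_of_pos h,
      div_mul_cancel₀ _ h.ne']

lemma proj_proj {x : X} {s n : ℝ} (hs : 0 ≤ s) (hsn : s ≤ n) (hn : n ≤ dist x₀ x) :
    proj x₀ (proj x₀ x n) s = proj x₀ x s := by
  refine (eq_proj_of_isometry (c := proj x₀ x) (ℓ := n) (by simp [proj]) (fun a ha b hb => ?_)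
    ⟨hs, hsn⟩).symm
  exact dist_proj_proj_self ⟨ha.1, ha.2.trans hn⟩ ⟨hb.1, hb.2.trans hn⟩

lemma dist_proj_le {x y : X} {s n : ℝ} (hs : 0 ≤ s) (hsn : s ≤ n) (hx : n ≤ dist x₀ x)
    (hy : n ≤ dist x₀ y) : dist (proj x₀ x s) (proj x₀ y s) ≤ dist (proj x₀ x n) (proj x₀ y n) := by
  have key := dist_geo_geo_le x₀ (proj x₀ x n) x₀ (proj x₀ y n) (s / n)
  rw [← proj_proj hs hsn hx, ← proj_proj hs hsn hy]
  unfold proj at key ⊢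
  have h1 := dist_proj (hs.trans hsn) hx
  have h2 := dist_proj (hs.trans hsn) hy
  unfold proj at h1 h2
  rw [h1, h2]
  simpa using key

lemma dist_proj_le_two_mul {x y : X} {s : ℝ} (hs : 0 ≤ s) (hx : s ≤ dist x₀ x)
    (hy : s ≤ dist x₀ y) : dist (proj x₀ x s) (proj x₀ y s) ≤ 2 * dist x y := by
  wlog h : dist x₀ x ≤ dist x₀ y generalizing x y
  · rw [dist_comm, dist_comm x]
    exact this hy hx (le_of_not_ge h)
  refine (dist_proj_le hs hx le_rfl h).trans ?_
  rw [proj_self]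
  have h1 := dist_proj_proj_self (x₀ := x₀) (x := y) ⟨dist_nonneg, h⟩ ⟨dist_nonneg, le_rfl⟩
  rw [proj_self, abs_sub_comm, abs_of_nonneg (sub_nonneg.2 h)] at h1
  have h2 := dist_triangle x y (proj x₀ y (dist x₀ x))
  have h3 := dist_triangle x₀ x y
  rw [dist_comm y] at h2
  linarith

end Bicombing

section PathClasses

open CategoryTheory

variable {T : Type u} [TopologicalSpace T]

/-- A point of `U` as an object of the fundamental groupoid of `U`. -/
abbrev ob (U : Set T) (x : T) (hx : x ∈ U) : FundamentalGroupoid U := ⟨⟨x, hx⟩⟩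

/-- A path in `T` contained in `U` as a path in the subspace `U`. -/
def Path.codRestrict {U : Set T} {x y : T} (p : Path x y) (h : ∀ t, p t ∈ U) :
    Path (⟨x, p.source ▸ h 0⟩ : U) ⟨y, p.target ▸ h 1⟩ where
  toFun t := ⟨p t, h t⟩
  continuous_toFun := p.continuous.subtype_mk h
  source' := Subtype.ext p.source
  target' := Subtype.ext p.target

/-- The class of a path contained in `U` in the fundamental groupoid of `U`. -/
def cls {U : Set T} {x y : T} (p : Path x y) (h : ∀ t, p t ∈ U) :
    ob U x (p.source ▸ h 0) ⟶ ob U y (p.target ▸ h 1) :=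
  Path.Homotopic.Quotient.mk (p.codRestrict h)

variable {U : Set T}

lemma cls_trans {x y z : T} (p : Path x y) (q : Path y z) (hp : ∀ t, p t ∈ U)
    (hq : ∀ t, q t ∈ U) (h : ∀ t, p.trans q t ∈ U) : cls (p.trans q) h = cls p hp ≫ cls q hq := by
  rw [FundamentalGroupoid.comp_eq, cls, cls, cls, ← Path.Homotopic.Quotient.mk_trans]
  congr 1
  ext t
  change p.trans q t = ((p.codRestrict hp).trans (q.codRestrict hq) t : U).1
  rw [Path.trans_apply, Path.trans_apply]
  split_ifs <;> rfl

lemma Path.trans_mem {x y z : T} {p : Path x y} {q : Path y z} (hp : ∀ t, p t ∈ U)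
    (hq : ∀ t, q t ∈ U) (t : I) : p.trans q t ∈ U := by
  rw [Path.trans_apply]
  split_ifs
  · exact hp _
  · exact hq _

lemma cls_refl {x : T} (h : ∀ t, Path.refl x t ∈ U) : cls (Path.refl x) h = 𝟙 (ob U x (h 0)) := rfl

lemma cls_symm {x y : T} (p : Path x y) (hp : ∀ t, p t ∈ U) :
    cls p.symm (fun _ => hp _) = inv (cls p hp) := by
  apply IsIso.eq_inv_of_hom_inv_id
  change Path.Homotopic.Quotient.trans (Path.Homotopic.Quotient.mk (p.codRestrict hp))
    (Path.Homotopic.Quotient.mk (p.codRestrict hp).symm) = _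
  rw [← Path.Homotopic.Quotient.mk_trans]
  exact Path.Homotopic.Quotient.eq.2 ⟨(Path.Homotopy.reflTransSymm _).symm⟩

/-- The two boundary routes of a square in `U` represent the same class. -/
lemma cls_square {x y z w : T} {F : I → I → T} (hF : Continuous fun p : I × I => F p.1 p.2)
    (hU : ∀ u v, F u v ∈ U) (a : Path x y) (b : Path y z) (c : Path x w) (d : Path w z)
    (ha : ∀ t, F 0 t = a t) (hb : ∀ t, F t 1 = b t) (hc : ∀ t, F t 0 = c t)
    (hd : ∀ t, F 1 t = d t) :
    cls a (fun t => ha t ▸ hU 0 t) ≫ cls b (fun t => hb t ▸ hU t 1) =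
      cls c (fun t => hc t ▸ hU t 0) ≫ cls d (fun t => hd t ▸ hU 1 t) := by
  obtain rfl : F 0 0 = x := by rw [ha, a.source]
  obtain rfl : F 0 1 = y := by rw [ha, a.target]
  obtain rfl : F 1 1 = z := by rw [hd, d.target]
  obtain rfl : F 1 0 = w := by rw [hc, c.target]
  let G : C(I × I, U) := ⟨fun p => ⟨F p.1 p.2, hU _ _⟩, hF.subtype_mk _⟩
  let pa : Path ((0, 0) : I × I) (0, 1) := ⟨⟨fun t => (0, t), by fun_prop⟩, rfl, rfl⟩
  let pb : Path ((0, 1) : I × I) (1, 1) := ⟨⟨fun t => (t, 1), by fun_prop⟩, rfl, rfl⟩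
  let pc : Path ((0, 0) : I × I) (1, 0) := ⟨⟨fun t => (t, 0), by fun_prop⟩, rfl, rfl⟩
  let pd : Path ((1, 0) : I × I) (1, 1) := ⟨⟨fun t => (1, t), by fun_prop⟩, rfl, rfl⟩
  have : ContractibleSpace I := (convex_Icc (0 : ℝ) 1).contractibleSpace ⟨0, by simp⟩
  have hom : (pa.trans pb).Homotopic (pc.trans pd) := SimplyConnectedSpace.paths_homotopic _ _
  have hom' := hom.map G
  rw [Path.map_trans, Path.map_trans] at hom'
  have e1 : pa.map G.continuous = a.codRestrict (fun t => ha t ▸ hU 0 t) := by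
    ext t; exact ha t
  have e2 : pb.map G.continuous = b.codRestrict (fun t => hb t ▸ hU t 1) := by
    ext t; exact hb t
  have e3 : pc.map G.continuous = c.codRestrict (fun t => hc t ▸ hU t 0) := by
    ext t; exact hc t
  have e4 : pd.map G.continuous = d.codRestrict (fun t => hd t ▸ hU 1 t) := by
    ext t; exact hd t
  rw [e1, e2, e3, e4] at hom'
  rw [FundamentalGroupoid.comp_eq, FundamentalGroupoid.comp_eq, cls, cls, cls, cls,
    ← Path.Homotopic.Quotient.mk_trans, ← Path.Homotopic.Quotient.mk_trans]
  exact Path.Homotopic.Quotient.eq.2 hom'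

lemma exists_homotopy_of_cls_eq {x y : T} {p q : Path x y} {hp : ∀ t, p t ∈ U}
    {hq : ∀ t, q t ∈ U} (h : cls p hp = cls q hq) :
    ∃ F : I × I → T, Continuous F ∧ (∀ z, F z ∈ U) ∧ (∀ t, F (0, t) = p t) ∧
      (∀ t, F (1, t) = q t) ∧ (∀ s, F (s, 0) = x) ∧ ∀ s, F (s, 1) = y := by
  obtain ⟨H⟩ := Path.Homotopic.Quotient.eq.1 h
  refine ⟨fun z => (H z : U).1, continuous_subtype_val.comp H.continuous, fun z => (H z).2,
    fun t => ?_, fun t => ?_, fun s => ?_, fun s => ?_⟩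
  · exact congrArg Subtype.val (H.apply_zero t)
  · exact congrArg Subtype.val (H.apply_one t)
  · exact congrArg Subtype.val (H.source s)
  · exact congrArg Subtype.val (H.target s)

/-- The class `c` is represented by a path contained in `V`. -/
def RepIn (V : Set T) {a b : FundamentalGroupoid U} (c : a ⟶ b) : Prop :=
  ∃ p : Path a.as.1 b.as.1, (∀ t, p t ∈ V) ∧ ∃ h : ∀ t, p t ∈ U, cls p h = c

variable {V : Set T} {a b c : FundamentalGroupoid U}

lemma RepIn.comp {f : a ⟶ b} {g : b ⟶ c} (hf : RepIn V f) (hg : RepIn V g) :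
    RepIn V (f ≫ g) := by
  obtain ⟨p, hp, hpU, rfl⟩ := hf
  obtain ⟨q, hq, hqU, rfl⟩ := hg
  exact ⟨p.trans q, Path.trans_mem hp hq, Path.trans_mem hpU hqU, cls_trans p q hpU hqU _⟩

lemma RepIn.inv {f : a ⟶ b} (hf : RepIn V f) : RepIn V (inv f) := by
  obtain ⟨p, hp, hpU, rfl⟩ := hf
  exact ⟨p.symm, fun t => hp _, fun t => hpU _, cls_symm p hpU⟩

lemma RepIn.mono {W : Set T} (hVW : V ⊆ W) {f : a ⟶ b} (hf : RepIn V f) : RepIn W f := by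
  obtain ⟨p, hp, hpU, rfl⟩ := hf
  exact ⟨p, fun t => hVW (hp t), hpU, rfl⟩

lemma repIn_cls {x y : T} (p : Path x y) (h : ∀ t, p t ∈ U) (hV : ∀ t, p t ∈ V) :
    RepIn V (cls p h) := ⟨p, hV, h, rfl⟩

end PathClasses

section RadialClasses

open CategoryTheory

variable {X : Type u} [MetricSpace X]

/-- The complement of the closed ball of radius `κ`. -/
def out (x₀ : X) (κ : ℝ) : Set X := {x | κ < dist x₀ x}

lemma mem_out_of_le {x₀ : X} {m : ℝ≥0} {x : X} (h : (m : ℝ) + 1 ≤ dist x₀ x) : x ∈ out x₀ m := by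
  change (m : ℝ) < _
  linarith

lemma out_anti (x₀ : X) {κ κ' : ℝ} (h : κ ≤ κ') : out x₀ κ' ⊆ out x₀ κ :=
  fun _ hx => h.trans_lt hx

variable [hX : Fact (IsCAT0Space X)]

lemma geo_mem_ball {a b c : X} {ρ : ℝ} (hb : b ∈ Metric.ball a ρ) (hc : c ∈ Metric.ball a ρ)
    (t : I) : geo b c t ∈ Metric.ball a ρ := by
  rw [Metric.mem_ball] at *
  have h := (geo_affineGeodesic b c).dist_le (geo_affineGeodesic a a) t.2
  rw [geo_self] at h
  have h0 := t.2.1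
  have h1 := t.2.2
  rcases h0.eq_or_lt with h0 | h0
  · rw [← h0] at h ⊢
    simpa using hb
  · nlinarith

/-- The geodesic as a path. -/
noncomputable def geoPath (x y : X) : Path x y where
  toFun t := geo x y t
  continuous_toFun := continuous_const.geo continuous_const continuous_subtype_val
  source' := geo_zero x y
  target' := geo_one x y

lemma geoPath_apply (x y : X) (t : I) : geoPath x y t = geo x y t := rfl

lemma cls_geo_triangle {U : Set X} {a b c : X} {ρ : ℝ} (hU : Metric.ball a ρ ⊆ U)
    (hb : b ∈ Metric.ball a ρ) (hc : c ∈ Metric.ball a ρ) (h₁ : ∀ t, geoPath a b t ∈ U)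
    (h₂ : ∀ t, geoPath b c t ∈ U) (h₃ : ∀ t, geoPath a c t ∈ U) :
    cls (geoPath a b) h₁ ≫ cls (geoPath b c) h₂ = cls (geoPath a c) h₃ := by
  have ha : a ∈ Metric.ball a ρ := Metric.mem_ball_self (dist_nonneg.trans_lt hb)
  have := cls_square (U := U) (F := fun u v => geo a (geo b c u) v)
    (continuous_const.geo (continuous_const.geo continuous_const (by fun_prop)) (by fun_prop))
    (fun u v => hU (geo_mem_ball ha (geo_mem_ball hb hc u) v))
    (geoPath a b) (geoPath b c) (Path.refl a) (geoPath a c)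
    (fun t => by simp [geoPath_apply]) (fun t => by simp [geoPath_apply]) (fun t => by simp)
    (fun t => by simp [geoPath_apply])
  rw [cls_refl, Category.id_comp] at this
  exact this

variable {x₀ : X} {m : ℝ≥0}

/-- The radial segment from `x` to the sphere of radius `s` (for `s ≤ dist x₀ x`). -/
noncomputable def radPath (x₀ x : X) (s : ℝ) : Path x (proj x₀ x s) where
  toFun t := proj x₀ x ((1 - t) * dist x₀ x + t * s)
  continuous_toFun := continuous_const.geo continuous_const (by fun_prop)
  source' := by simp [proj_self]
  target' := by simp

lemma radPath_apply (x : X) (s : ℝ) (t : I) :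
    radPath x₀ x s t = proj x₀ x ((1 - t) * dist x₀ x + t * s) := rfl

lemma dist_radPath {x : X} {s : ℝ} (hs : 0 ≤ s) (hsx : s ≤ dist x₀ x) (t : I) :
    s ≤ (1 - t) * dist x₀ x + t * s ∧
      dist x₀ (radPath x₀ x s t) = (1 - t) * dist x₀ x + t * s := by
  have h0 := t.2.1
  have h1 := t.2.2
  have : s ≤ (1 - t) * dist x₀ x + t * s := by nlinarith
  exact ⟨this, dist_proj (hs.trans this) (by nlinarith)⟩

/-- `x` and `y` lie outside the ball of radius `m + 1`, and have nearby projections to it. -/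
structure Close (x₀ : X) (m : ℝ≥0) (x y : X) : Prop where
  left : (m : ℝ) + 1 ≤ dist x₀ x
  right : (m : ℝ) + 1 ≤ dist x₀ y
  near : dist (proj x₀ x (m + 1)) (proj x₀ y (m + 1)) < 1

lemma Close.symm {x y : X} (h : Close x₀ m x y) : Close x₀ m y x :=
  ⟨h.right, h.left, dist_comm (proj x₀ x (m + 1)) _ ▸ h.near⟩

lemma Close.refl {x : X} (h : (m : ℝ) + 1 ≤ dist x₀ x) : Close x₀ m x x := ⟨h, h, by simp⟩

lemma m_add_one_nonneg (m : ℝ≥0) : (0 : ℝ) ≤ m + 1 := by positivity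

lemma radPath_mem {x : X} (h : (m : ℝ) + 1 ≤ dist x₀ x) (t : I) :
    radPath x₀ x (m + 1) t ∈ out x₀ m := by
  obtain ⟨h1, h2⟩ := dist_radPath (m_add_one_nonneg m) h t
  change (m : ℝ) < _
  linarith

lemma ball_proj_subset {x : X} (h : (m : ℝ) + 1 ≤ dist x₀ x) :
    Metric.ball (proj x₀ x (m + 1)) 1 ⊆ out x₀ m := by
  intro z hz
  have h1 := dist_proj (m_add_one_nonneg m) h
  rw [Metric.mem_ball] at hz
  have := dist_triangle x₀ z (proj x₀ x (m + 1))
  change (m : ℝ) < _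
  linarith

lemma Close.mem_ball {x y : X} (h : Close x₀ m x y) :
    proj x₀ y (m + 1) ∈ Metric.ball (proj x₀ x (m + 1)) 1 := by
  rw [Metric.mem_ball']
  exact h.near

lemma Close.geoPath_mem {x y : X} (h : Close x₀ m x y) (t : I) :
    geoPath (proj x₀ x (m + 1)) (proj x₀ y (m + 1)) t ∈ out x₀ m :=
  ball_proj_subset h.left (geo_mem_ball (Metric.mem_ball_self one_pos) h.mem_ball t)

/-- The class of the path going from `x` radially to the sphere of radius `m + 1`, along a short
geodesic, and radially to `y`. -/
noncomputable def Close.cls {x y : X} (h : Close x₀ m x y) :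
    ob (out x₀ m) x (mem_out_of_le h.left) ⟶ ob (out x₀ m) y (mem_out_of_le h.right) :=
  _root_.cls (radPath x₀ x (m + 1)) (radPath_mem h.left) ≫
    _root_.cls (geoPath _ _) h.geoPath_mem ≫
      inv (_root_.cls (radPath x₀ y (m + 1)) (radPath_mem h.right))

lemma Close.cls_comp {x y z : X} (h₁ : Close x₀ m x y) (h₂ : Close x₀ m y z)
    (h₃ : Close x₀ m x z) : h₁.cls ≫ h₂.cls = h₃.cls := by
  have := cls_geo_triangle (ball_proj_subset h₁.left) h₁.mem_ball h₃.mem_ball h₁.geoPath_mem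
    h₂.geoPath_mem h₃.geoPath_mem
  simp only [Close.cls, Category.assoc, IsIso.inv_hom_id_assoc, ← this]

lemma Close.cls_self {x : X} (h : Close x₀ m x x) : h.cls = 𝟙 _ := by
  have := h.cls_comp h h
  rwa [← cancel_mono h.cls, Category.id_comp]

lemma Close.cls_symm {x y : X} (h : Close x₀ m x y) (h' : Close x₀ m y x) :
    h'.cls = inv h.cls := by
  apply IsIso.eq_inv_of_hom_inv_id
  rw [h.cls_comp h' (Close.refl h.left), Close.cls_self]

/-- A path along which the projection to the sphere of radius `m + 1` stays close to its initial
value represents the radial class. -/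
lemma cls_eq_close_cls {x y : X} (p : Path x y) (h : ∀ t, Close x₀ m x (p t))
    (hxy : Close x₀ m x y) :
    cls p (fun t => mem_out_of_le (h t).right) = hxy.cls := by
  have hpos : ∀ u, 0 < dist x₀ (p u) := fun u =>
    (by positivity : (0 : ℝ) < m + 1).trans_le (h u).right
  have hq : Continuous fun u : I => proj x₀ (p u) (m + 1) :=
    p.continuous.proj continuous_const hpos
  let q : Path (proj x₀ x (m + 1)) (proj x₀ y (m + 1)) := ⟨⟨_, hq⟩, by simp, by simp⟩
  have sq1 := cls_square (U := out x₀ m)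
    (F := fun u v => proj x₀ (p u) ((1 - v) * dist x₀ (p u) + v * (m + 1)))
    (Continuous.proj (by fun_prop) (by fun_prop) fun z => hpos z.1)
    (fun u v => radPath_mem (h u).right v) (radPath x₀ x (m + 1)) q p (radPath x₀ y (m + 1))
    (fun t => by simp [radPath_apply]) (fun t => by simp [q]) (fun t => by simp [proj_self])
    (fun t => by simp [radPath_apply])
  have sq2 := cls_square (U := out x₀ m)
    (F := fun u v => geo (proj x₀ x (m + 1)) (proj x₀ (p u) (m + 1)) v)
    (continuous_const.geo (hq.comp continuous_fst) (by fun_prop))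
    (fun u v => (h u).geoPath_mem v) (Path.refl _) q (Path.refl _) (geoPath _ _)
    (fun t => by simp) (fun t => by simp [q]) (fun t => by simp)
    (fun t => by simp [geoPath_apply])
  rw [cls_refl, Category.id_comp, Category.id_comp] at sq2
  rw [sq2, ← IsIso.comp_inv_eq, Category.assoc] at sq1
  exact sq1.symm

end RadialClasses

section Subpaths

open CategoryTheory

variable {T : Type u} [TopologicalSpace T] {U : Set T}

lemma Path.subpath_mem {x y : T} {p : Path x y} (h : ∀ t, p t ∈ U) (s t u : I) :
    p.subpath s t u ∈ U := h _

lemma cls_subpath_trans {x y : T} (p : Path x y) (h : ∀ t, p t ∈ U) (r s t : I) :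
    cls (p.subpath r s) (Path.subpath_mem h r s) ≫ cls (p.subpath s t) (Path.subpath_mem h s t) =
      cls (p.subpath r t) (Path.subpath_mem h r t) :=
  Path.Homotopic.Quotient.eq.2 ⟨Path.Homotopy.subpathTransSubpath (p.codRestrict h) r s t⟩

lemma Path.exists_subpath_mem {x y : T} (p : Path x y) (τ : I) {W : Set T} (hW : W ∈ 𝓝 (p τ)) :
    ∀ᶠ t in 𝓝 τ, ∀ u, p.subpath τ t u ∈ W := by
  obtain ⟨δ, hδ, hball⟩ := Metric.mem_nhds_iff.1 (p.continuous.continuousAt.preimage_mem_nhds hW)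
  filter_upwards [Metric.ball_mem_nhds τ hδ] with t ht u
  have hr : p.subpath τ t u ∈ p '' uIcc τ t := by
    rw [← Path.range_subpath]
    exact mem_range_self u
  obtain ⟨v, hv, h⟩ := hr
  rw [← h]
  apply hball
  rw [Metric.mem_ball, Subtype.dist_eq, Real.dist_eq] at *
  refine lt_of_le_of_lt ?_ ht
  have hv' : (v : ℝ) ∈ uIcc (t : ℝ) τ := by
    rcases mem_uIcc.1 hv with h | h
    · exact mem_uIcc.2 (Or.inr h)
    · exact mem_uIcc.2 (Or.inl h)
  rw [abs_sub_comm, abs_sub_comm (t : ℝ)]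
  exact abs_sub_right_of_mem_uIcc hv'

lemma cls_congr {x y : T} {p q : Path x y} (e : p = q) (hp : ∀ t, p t ∈ U)
    (hq : ∀ t, q t ∈ U) : cls p hp = cls q hq := by
  subst e
  rfl

lemma cls_subpath_symm {x y : T} (p : Path x y) (h : ∀ t, p t ∈ U) (s t : I) :
    cls (p.subpath t s) (Path.subpath_mem h t s) =
      inv (cls (p.subpath s t) (Path.subpath_mem h s t)) :=
  (cls_congr (Path.symm_subpath p s t).symm _ _).trans (cls_symm _ (Path.subpath_mem h s t))

/-- A property of path classes that is stable under composition and holds for short paths in `V`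
(and their inverses) holds for all paths in `V`. -/
lemma cls_induction {V : Set T} {Q : ∀ ⦃a b : FundamentalGroupoid U⦄, (a ⟶ b) → Prop}
    (comp : ∀ ⦃a b c : FundamentalGroupoid U⦄ (f : a ⟶ b) (g : b ⟶ c), Q f → Q g → Q (f ≫ g))
    (loc : ∀ z ∈ V, ∃ W ∈ 𝓝 z, ∀ w (p : Path z w) (h : ∀ t, p t ∈ U), (∀ t, p t ∈ W) →
      (∀ t, p t ∈ V) → Q (cls p h) ∧ Q (inv (cls p h)))
    {x y : T} (p : Path x y) (hV : ∀ t, p t ∈ V) (h : ∀ t, p t ∈ U) : Q (cls p h) := by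
  have key : Q (cls (p.subpath 0 1) (Path.subpath_mem h 0 1)) := by
    refine PreconnectedSpace.induction₂' (α := I)
      (fun s t => Q (cls (p.subpath s t) (Path.subpath_mem h s t))) (fun τ => ?_)
      ⟨fun r s t hrs hst => ?_⟩ 0 1
    · obtain ⟨W, hW, hloc⟩ := loc (p τ) (hV τ)
      filter_upwards [p.exists_subpath_mem τ hW] with t ht
      rw [cls_subpath_symm p h τ t]
      exact hloc _ _ _ ht (Path.subpath_mem hV _ _)
    · rw [← cls_subpath_trans p h r s t]
      exact comp _ _ hrs hst
  have aux : ∀ {x' y' : T} (_ : x' = x) (_ : y' = y) (q : Path x' y') (hq : ∀ t, q t ∈ U),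
      (∀ t, q t = p t) → Q (cls q hq) → Q (cls p h) := by
    rintro x' y' rfl rfl q hq hqp hQ
    obtain rfl : q = p := by ext t; exact hqp t
    exact hQ
  exact aux p.source p.target _ _ (fun t => by simp [Path.subpath]) key

end Subpaths

section Countability

open CategoryTheory

lemma exists_countable_comp_closed {C : Type*} [Category C] (a : C) {D : Set C}
    (hD : D.Countable) (G : ∀ z d : C, Set (z ⟶ d)) (hG : ∀ z d, (G z d).Countable) :
    ∃ S : Set (Σ z, (a ⟶ z)), S.Countable ∧ ⟨a, 𝟙 a⟩ ∈ S ∧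
      ∀ z c, ⟨z, c⟩ ∈ S → ∀ d ∈ D, ∀ g ∈ G z d, ⟨d, c ≫ g⟩ ∈ S := by
  let step : Set (Σ z, (a ⟶ z)) → Set (Σ z, (a ⟶ z)) := fun S =>
    ⋃ x ∈ S, ⋃ d ∈ D, (fun g => ⟨d, x.2 ≫ g⟩) '' G x.1 d
  refine ⟨⋃ n : ℕ, step^[n] {⟨a, 𝟙 a⟩}, countable_iUnion fun n => ?_,
    mem_iUnion.2 ⟨0, mem_singleton _⟩, ?_⟩
  · induction n with
    | zero => exact countable_singleton _
    | succ n ih =>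
      rw [Function.iterate_succ_apply']
      exact ih.biUnion fun x _ => hD.biUnion fun d _ => (hG _ _).image _
  · intro z c h d hd g hg
    obtain ⟨n, hn⟩ := mem_iUnion.1 h
    refine mem_iUnion.2 ⟨n + 1, ?_⟩
    rw [Function.iterate_succ_apply']
    simp only [step, mem_iUnion]
    exact ⟨_, hn, d, hd, g, hg, rfl⟩

variable {X : Type u} [MetricSpace X]

lemma ball_subset_out (x₀ : X) (m : ℝ≥0) (z : X) : Metric.ball z (dist x₀ z - m) ⊆ out x₀ m := by
  intro w hw
  rw [Metric.mem_ball] at hw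
  have := dist_triangle x₀ w z
  change (m : ℝ) < _
  linarith

variable [hX : Fact (IsCAT0Space X)]

lemma geoPath_mem_out {x₀ : X} {m : ℝ≥0} {z w : X} (hz : (m : ℝ) < dist x₀ z)
    (h : dist w z < dist x₀ z - m) (t : I) : geoPath z w t ∈ out x₀ m :=
  ball_subset_out x₀ m z (geo_mem_ball (Metric.mem_ball_self (by linarith)) h t)

lemma cls_eq_cls_geoPath {U : Set X} {x y : X} {ρ : ℝ} (hU : Metric.ball x ρ ⊆ U) (p : Path x y)
    (h : ∀ t, p t ∈ Metric.ball x ρ) (hp : ∀ t, p t ∈ U) (hg : ∀ t, geoPath x y t ∈ U) :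
    cls p hp = cls (geoPath x y) hg := by
  have hx : x ∈ Metric.ball x ρ := by simpa using h 0
  have sq := cls_square (U := U) (F := fun u v => geo x (p u) v)
    (continuous_const.geo (by fun_prop) (by fun_prop))
    (fun u v => hU (geo_mem_ball hx (h u) v)) (Path.refl _) p (Path.refl _) (geoPath _ _)
    (fun t => by simp) (fun t => by simp) (fun t => by simp)
    (fun t => by simp [geoPath_apply])
  rwa [cls_refl, Category.id_comp, Category.id_comp] at sq

instance countable_hom_out [TopologicalSpace.SeparableSpace X] (x₀ : X) (m : ℝ≥0)
    (a b : FundamentalGroupoid (out x₀ m)) : Countable (a ⟶ b) := by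
  obtain ⟨s, hs, hsd⟩ := TopologicalSpace.exists_countable_dense X
  let D : Set (FundamentalGroupoid (out x₀ m)) := {z | z.as.1 ∈ insert b.as.1 s}
  have hD : D.Countable :=
    (hs.insert _).preimage_of_injOn (f := fun z : FundamentalGroupoid (out x₀ m) => z.as.1)
      fun z _ w _ h => FundamentalGroupoid.ext (Subtype.ext h)
  have hDd : ∀ (z : X) (ε : ℝ), 0 < ε → ∃ d ∈ insert b.as.1 s, dist z d < ε := fun z ε hε =>
    (hsd.mono (subset_insert _ _)).exists_dist_lt z hε
  let G : ∀ z d : FundamentalGroupoid (out x₀ m), Set (z ⟶ d) := fun z d =>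
    {g | dist d.as.1 z.as.1 < (dist x₀ z.as.1 - m) / 2 ∧
      ∃ h : ∀ t, geoPath z.as.1 d.as.1 t ∈ out x₀ m, g = cls (geoPath z.as.1 d.as.1) h}
  have hG : ∀ z d, (G z d).Countable := fun z d => Subsingleton.countable <| by
    rintro g ⟨-, h, rfl⟩ g' ⟨-, h', rfl⟩
    rfl
  obtain ⟨S, hS, ha, hSG⟩ := exists_countable_comp_closed a hD G hG
  let Reach : ∀ A : FundamentalGroupoid (out x₀ m), (a ⟶ A) → Prop := fun A c =>
    ∀ z (hz : z ∈ out x₀ m), z ∈ insert b.as.1 s → dist z A.as.1 < (dist x₀ A.as.1 - m) / 8 →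
      ∀ h : ∀ t, geoPath A.as.1 z t ∈ out x₀ m, ⟨ob _ z hz, c ≫ cls (geoPath A.as.1 z) h⟩ ∈ S
  let Q : ∀ ⦃A B : FundamentalGroupoid (out x₀ m)⦄, (A ⟶ B) → Prop := fun A B f =>
    ∀ c, Reach A c → Reach B (c ≫ f)
  have hQ : ∀ {x y : X} (p : Path x y) (h : ∀ t, p t ∈ out x₀ m), Q (cls p h) := by
    intro x y p h
    refine cls_induction (Q := Q) (V := out x₀ m) (fun A B C f g hf hg c hc => ?_) ?_ p h h
    · rw [← Category.assoc]
      exact hg _ (hf _ hc)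
    · intro z hz
      have hρ : 0 < dist x₀ z - m := sub_pos.2 hz
      set ρ := dist x₀ z - m with hρd
      refine ⟨Metric.ball z (ρ / 16), Metric.ball_mem_nhds _ (by positivity), ?_⟩
      intro w p h hW _
      have hw : dist w z < ρ / 16 := by simpa using hW 1
      rw [cls_eq_cls_geoPath (ball_subset_out x₀ m z) p
        (fun t => Metric.ball_subset_ball (by linarith) (hW t)) h
        (geoPath_mem_out hz (by linarith))]
      have hrw : ρ - ρ / 16 < dist x₀ w - m ∧ dist x₀ w - m < ρ + ρ / 16 := by
        have h1 := dist_triangle x₀ w z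
        have h2 := dist_triangle x₀ z w
        rw [dist_comm z w] at h2
        constructor <;> linarith
      have tri : ∀ (u v : X) (hu : dist u z < ρ) (hv : dist v z < ρ) h₁ h₂ h₃,
          cls (geoPath z u) h₁ ≫ cls (geoPath u v) h₂ = cls (geoPath z v) h₃ :=
        fun u v hu hv h₁ h₂ h₃ => cls_geo_triangle (ball_subset_out x₀ m z) hu hv h₁ h₂ h₃
      constructor
      · intro c hc v hv hvD hvw hgv
        change dist v w < (dist x₀ w - m) / 8 at hvw
        obtain ⟨d, hd, hdz⟩ := hDd z (ρ / 16) (by positivity)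
        rw [dist_comm] at hdz
        have t1 := dist_triangle x₀ d z
        have t2 := dist_triangle v w z
        have t3 := dist_triangle v z d
        have t4 := dist_triangle x₀ z d
        rw [dist_comm z d] at t3 t4
        have hdo : d ∈ out x₀ m := ball_subset_out x₀ m z (show dist d z < _ by linarith)
        have gzd := geoPath_mem_out (x₀ := x₀) (m := m) (w := d) hz (by linarith)
        have gdv := geoPath_mem_out (x₀ := x₀) (m := m) (w := v) hdo (by linarith)
        have := hSG (ob _ d hdo) _ (hc d hdo hd (show dist d z < ρ / 8 by linarith) gzd)
          (ob _ v hv) hvD (cls (geoPath d v) gdv)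
          ⟨show dist v d < (dist x₀ d - m) / 2 by linarith, gdv, rfl⟩
        convert this using 2
        simp only [Category.assoc]
        congr 1
        have gzv := geoPath_mem_out (x₀ := x₀) (m := m) (w := v) hz (by linarith)
        exact (tri w v (by linarith) (by linarith) _ _ gzv).trans
          (tri d v (by linarith) (by linarith) _ _ gzv).symm
      · intro c hc v hv hvD hvz hgv
        change dist v z < ρ / 8 at hvz
        obtain ⟨d, hd, hdw⟩ := hDd w (ρ / 16) (by positivity)
        rw [dist_comm] at hdw
        have t1 := dist_triangle x₀ d w
        have t2 := dist_triangle d w z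
        have t3 := dist_triangle v z d
        have t4 := dist_triangle x₀ w d
        have t5 := dist_triangle x₀ z d
        rw [dist_comm z d] at t3 t5
        rw [dist_comm w d] at t4
        have hwo : w ∈ out x₀ m := ball_subset_out x₀ m z (show dist w z < _ by linarith)
        have hdo : d ∈ out x₀ m := ball_subset_out x₀ m z (show dist d z < _ by linarith)
        have gzd := geoPath_mem_out (x₀ := x₀) (m := m) (w := d) hz (by linarith)
        have gwd := geoPath_mem_out (x₀ := x₀) (m := m) (w := d) hwo (by linarith)
        have gdv := geoPath_mem_out (x₀ := x₀) (m := m) (w := v) hdo (by linarith)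
        have := hSG (ob _ d hdo) _
          (hc d hdo hd (show dist d w < (dist x₀ w - m) / 8 by linarith) gwd)
          (ob _ v hv) hvD (cls (geoPath d v) gdv)
          ⟨show dist v d < (dist x₀ d - m) / 2 by linarith, gdv, rfl⟩
        convert this using 2
        simp only [Category.assoc]
        congr 1
        rw [IsIso.inv_comp_eq, ← Category.assoc, tri w d (by linarith) (by linarith) _ _ gzd]
        exact (tri d v (by linarith) (by linarith) _ _ hgv).symm
  have hSf : ∀ f : a ⟶ b, (⟨b, f⟩ : Σ z, (a ⟶ z)) ∈ S := by
    intro f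
    obtain ⟨p, rfl⟩ := Path.Homotopic.Quotient.mk_surjective f
    have hp := hQ (p.map continuous_subtype_val) (fun t => (p t).2) (𝟙 a) (by
      intro z hz hzD hza hg
      exact hSG a _ ha (ob _ z hz) hzD (cls _ hg) ⟨by
        have : 0 < dist x₀ a.as.1 - m := sub_pos.2 a.as.2
        linarith, hg, rfl⟩) b.as.1 b.as.2 (mem_insert _ _) (by
        have : 0 < dist x₀ b.as.1 - m := sub_pos.2 b.as.2
        rw [dist_self]
        positivity) (fun t => by rw [geoPath_apply, geo_self]; exact b.as.2)
    have e : geoPath b.as.1 b.as.1 = Path.refl _ := by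
      ext t
      simp [geoPath_apply]
    rw [cls_congr e _ fun _ => b.as.2] at hp
    convert hp using 2
    rw [Category.id_comp]
    exact (Category.comp_id (obj := FundamentalGroupoid (out x₀ m)) (X := a) (Y := b) _).symm
  exact countable_univ_iff.1 ((hS.preimage_of_injOn (f := fun f : a ⟶ b => ⟨b, f⟩)
    fun f _ g _ h => by simpa using h).mono fun f _ => hSf f)

end Countability

section Rays

open CategoryTheory

variable {X : Type u} [MetricSpace X]

/-- The space of geodesic rays issuing from `x₀`, with the topology of pointwise convergence. -/
abbrev RaySpace (x₀ : X) : Type u :=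
  {ξ : ℝ≥0 → X // ξ 0 = x₀ ∧ ∀ s t, dist (ξ s) (ξ t) = |(s : ℝ) - t|}

variable {x₀ : X}

namespace RaySpace

lemma dist_apply (ξ : RaySpace x₀) (t : ℝ≥0) : dist x₀ (ξ.1 t) = t := by
  have := ξ.2.2 0 t
  rw [ξ.2.1] at this
  simpa using this

lemma continuous_coe (ξ : RaySpace x₀) : Continuous ξ.1 := by
  refine (LipschitzWith.of_dist_le_mul (K := 1) fun s t => ?_).continuous
  rw [ξ.2.2, NNReal.dist_eq, NNReal.coe_one, one_mul]

lemma continuous_eval (t : ℝ≥0) : Continuous fun ξ : RaySpace x₀ => ξ.1 t :=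
  (continuous_apply t).comp continuous_subtype_val

lemma le_dist {m : ℝ≥0} (ξ : RaySpace x₀) {t : ℝ≥0} (h : m + 1 ≤ t) :
    (m : ℝ) + 1 ≤ dist x₀ (ξ.1 t) := by
  rw [dist_apply]
  exact_mod_cast h

/-- A segment of a geodesic ray. -/
noncomputable def seg (ξ : RaySpace x₀) (s t : ℝ≥0) : Path (ξ.1 s) (ξ.1 t) where
  toFun u := ξ.1 ((1 - u) * s + u * t : ℝ).toNNReal
  continuous_toFun := ξ.continuous_coe.comp (by fun_prop)
  source' := by simp
  target' := by simp

lemma exists_seg_eq (ξ : RaySpace x₀) (s t : ℝ≥0) (u : I) :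
    ∃ r : ℝ≥0, min s t ≤ r ∧ ξ.seg s t u = ξ.1 r := by
  refine ⟨_, ?_, rfl⟩
  apply NNReal.le_toNNReal_of_coe_le
  rw [NNReal.coe_min]
  have h0 := u.2.1
  have h1 := u.2.2
  nlinarith [min_le_left (s : ℝ) t, min_le_right (s : ℝ) t]

lemma seg_mem (ξ : RaySpace x₀) {s t : ℝ≥0} {κ : ℝ} (hs : κ < s) (ht : κ < t) (u : I) :
    ξ.seg s t u ∈ out x₀ κ := by
  obtain ⟨r, hr, h⟩ := ξ.exists_seg_eq s t u
  rw [h]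
  change κ < _
  rw [dist_apply]
  have : ((min s t : ℝ≥0) : ℝ) ≤ r := by exact_mod_cast hr
  rw [NNReal.coe_min] at this
  exact (lt_min hs ht).trans_le this

instance [ProperSpace X] : CompactSpace (RaySpace x₀) := by
  refine isCompact_iff_compactSpace.1
    (?_ : IsCompact {ξ : ℝ≥0 → X | ξ 0 = x₀ ∧ ∀ s t, dist (ξ s) (ξ t) = |(s : ℝ) - t|})
  refine (isCompact_univ_pi fun t : ℝ≥0 => isCompact_closedBall x₀ (t : ℝ)).of_isClosed_subset ?_
    fun ξ hξ t _ => ?_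
  · have : {ξ : ℝ≥0 → X | ξ 0 = x₀ ∧ ∀ s t, dist (ξ s) (ξ t) = |(s : ℝ) - t|} =
        {ξ | ξ 0 = x₀} ∩ ⋂ s : ℝ≥0, ⋂ t : ℝ≥0, {ξ | dist (ξ s) (ξ t) = |(s : ℝ) - t|} := by
      ext
      simp
    rw [this]
    exact (isClosed_eq (continuous_apply 0) continuous_const).inter <|
      isClosed_iInter fun s => isClosed_iInter fun t =>
        isClosed_eq ((continuous_apply s).dist (continuous_apply t)) continuous_const
  · exact (dist_comm _ _).trans_le (dist_apply ⟨ξ, hξ⟩ t).le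

end RaySpace

variable [hX : Fact (IsCAT0Space X)]

namespace RaySpace

lemma proj_apply (ξ : RaySpace x₀) {s t : ℝ≥0} (h : s ≤ t) : proj x₀ (ξ.1 t) s = ξ.1 s := by
  have := eq_proj_of_isometry (x₀ := x₀) (c := fun r => ξ.1 r.toNNReal) (ℓ := t) (s := s)
    (by simpa using ξ.2.1) (fun a ha b hb => by
      rw [ξ.2.2, Real.coe_toNNReal _ ha.1, Real.coe_toNNReal _ hb.1]) ⟨s.2, h⟩
  simpa using this.symm

lemma dist_apply_mono (ξ η : RaySpace x₀) {s t : ℝ≥0} (h : s ≤ t) :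
    dist (ξ.1 s) (η.1 s) ≤ dist (ξ.1 t) (η.1 t) := by
  have := dist_proj_le (x₀ := x₀) (x := ξ.1 t) (y := η.1 t) s.2 (NNReal.coe_le_coe.2 h)
    (ξ.dist_apply t).ge (η.dist_apply t).ge
  rwa [NNReal.val_eq_coe, ξ.proj_apply h, η.proj_apply h, ξ.proj_apply le_rfl,
    η.proj_apply le_rfl] at this

variable {m : ℝ≥0}

lemma proj_add_one (ξ : RaySpace x₀) {t : ℝ≥0} (h : m + 1 ≤ t) :
    proj x₀ (ξ.1 t) (m + 1) = ξ.1 (m + 1) := by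
  have := ξ.proj_apply h
  push_cast at this
  exact this

lemma close (ξ η : RaySpace x₀) (h : dist (ξ.1 (m + 1)) (η.1 (m + 1)) < 1) {s t : ℝ≥0}
    (hs : m + 1 ≤ s) (ht : m + 1 ≤ t) : Close x₀ m (ξ.1 s) (η.1 t) :=
  ⟨ξ.le_dist hs, η.le_dist ht, by rwa [proj_add_one ξ hs, proj_add_one η ht]⟩

lemma close_self (ξ : RaySpace x₀) {s t : ℝ≥0} (hs : m + 1 ≤ s) (ht : m + 1 ≤ t) :
    Close x₀ m (ξ.1 s) (ξ.1 t) :=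
  ξ.close ξ (by simp) hs ht

lemma le_of_close {ξ η : RaySpace x₀} {s t : ℝ≥0} (h : Close x₀ m (ξ.1 s) (η.1 t)) :
    m + 1 ≤ s ∧ m + 1 ≤ t := by
  have h1 := h.left
  have h2 := h.right
  rw [dist_apply] at h1 h2
  exact ⟨by exact_mod_cast h1, by exact_mod_cast h2⟩

lemma near_of_close {ξ η : RaySpace x₀} {s t : ℝ≥0} (h : Close x₀ m (ξ.1 s) (η.1 t)) :
    dist (ξ.1 (m + 1)) (η.1 (m + 1)) < 1 := by
  have := h.near
  rwa [proj_add_one ξ (le_of_close h).1, proj_add_one η (le_of_close h).2] at this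

lemma cls_seg (ξ : RaySpace x₀) {s t : ℝ≥0} (h : Close x₀ m (ξ.1 s) (ξ.1 t))
    (h' : ∀ u, ξ.seg s t u ∈ out x₀ m) : cls (ξ.seg s t) h' = h.cls := by
  refine cls_eq_close_cls _ (fun u => ?_) h
  obtain ⟨r, hr, e⟩ := ξ.exists_seg_eq s t u
  rw [e]
  exact ξ.close_self (le_of_close h).1 ((le_min (le_of_close h).1 (le_of_close h).2).trans hr)

lemma repIn_cls_self (ξ : RaySpace x₀) {s t : ℝ≥0} {κ : ℝ} (h : Close x₀ m (ξ.1 s) (ξ.1 t))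
    (hs : κ < s) (ht : κ < t) : RepIn (out x₀ κ) h.cls := by
  have h1 := le_of_close h
  have h' : ∀ u, ξ.seg s t u ∈ out x₀ m := ξ.seg_mem
    (by have : (m : ℝ) + 1 ≤ s := by exact_mod_cast h1.1
        linarith)
    (by have : (m : ℝ) + 1 ≤ t := by exact_mod_cast h1.2
        linarith)
  rw [← ξ.cls_seg h h']
  exact repIn_cls _ _ (ξ.seg_mem hs ht)

lemma repIn_shift {ξ η : RaySpace x₀} {s t : ℝ≥0} {κ : ℝ} (h : Close x₀ m (ξ.1 s) (η.1 s))
    (h' : Close x₀ m (ξ.1 t) (η.1 t)) (hs : κ < s) (ht : κ < t)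
    (hrep : RepIn (out x₀ κ) h'.cls) : RepIn (out x₀ κ) h.cls := by
  have hs' := (le_of_close h).1
  have ht' := (le_of_close h').1
  rw [← (ξ.close_self hs' ht').cls_comp (ξ.close η (near_of_close h) ht' hs') h,
    ← h'.cls_comp (η.close_self ht' hs') (ξ.close η (near_of_close h) ht' hs')]
  exact (ξ.repIn_cls_self _ hs ht).comp (hrep.comp (η.repIn_cls_self _ ht hs))

end RaySpace

/-- Two nearby points are joined by a radial class that can be pushed out. -/
lemma repIn_cls_of_dist_lt {m : ℝ≥0} {κ : ℝ} {x y : X} (hκ : (m : ℝ) + 1 ≤ κ)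
    (hx : κ + 1 / 2 ≤ dist x₀ x) (hxy : dist x y < 1 / 2) :
    ∃ h : Close x₀ m x y, RepIn (out x₀ κ) h.cls := by
  have hball : ∀ z ∈ Metric.ball x (1 / 2), κ < dist x₀ z ∧ Close x₀ m x z := by
    intro z hz
    rw [Metric.mem_ball] at hz
    have h1 := dist_triangle x₀ z x
    refine ⟨by linarith, by linarith, by linarith, ?_⟩
    refine (dist_proj_le_two_mul (m_add_one_nonneg m) (by linarith) (by linarith)).trans_lt ?_
    rw [dist_comm] at hz
    linarith
  have hx' : x ∈ Metric.ball x (1 / 2) := Metric.mem_ball_self (by norm_num)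
  have hy' : y ∈ Metric.ball x (1 / 2) := by rwa [Metric.mem_ball, dist_comm]
  refine ⟨(hball y hy').2, ?_⟩
  rw [← cls_eq_close_cls (geoPath x y) (fun t => (hball _ (geo_mem_ball hx' hy' t)).2)]
  exact repIn_cls _ _ fun t => (hball _ (geo_mem_ball hx' hy' t)).1

/-- The radial classes between the rays `ξ` and `η` can be pushed out of the ball of
radius `κ`. -/
def RayRel (m : ℝ≥0) (κ : ℝ) (ξ η : RaySpace x₀) : Prop :=
  dist (ξ.1 (m + 1)) (η.1 (m + 1)) < 1 ∧
    ∀ t : ℝ≥0, ∀ h : Close x₀ m (ξ.1 t) (η.1 t), κ < t → RepIn (out x₀ κ) h.cls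

namespace RayRel

variable {m : ℝ≥0} {κ : ℝ} {ξ η ζ : RaySpace x₀}

lemma refl (ξ : RaySpace x₀) : RayRel m κ ξ ξ :=
  ⟨by simp, fun _ h ht => ξ.repIn_cls_self h ht ht⟩

lemma symm (h : RayRel m κ ξ η) : RayRel m κ η ξ :=
  ⟨dist_comm (ξ.1 (m + 1)) _ ▸ h.1, fun t hc ht => by
    rw [Close.cls_symm hc.symm hc]
    exact (h.2 t hc.symm ht).inv⟩

lemma trans (hV : dist (ξ.1 (m + 1)) (ζ.1 (m + 1)) < 1) (h₁ : RayRel m κ ξ η)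
    (h₂ : RayRel m κ η ζ) : RayRel m κ ξ ζ :=
  ⟨hV, fun t hc ht => by
    have hm := (RaySpace.le_of_close hc).1
    have c₁ := ξ.close η h₁.1 hm hm
    have c₂ := η.close ζ h₂.1 hm hm
    rw [← c₁.cls_comp c₂ hc]
    exact (h₁.2 t c₁ ht).comp (h₂.2 t c₂ ht)⟩

lemma of_time {t : ℝ≥0} (h : Close x₀ m (ξ.1 t) (η.1 t)) (ht : κ < t)
    (hrep : RepIn (out x₀ κ) h.cls) : RayRel m κ ξ η :=
  ⟨RaySpace.near_of_close h, fun _ hc hs => RaySpace.repIn_shift hc h hs ht hrep⟩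

lemma anti {κ' : ℝ} (hκ : κ ≤ κ') (h : RayRel m κ' ξ η) : RayRel m κ ξ η := by
  obtain ⟨t, ht⟩ : ∃ t : ℝ≥0, max (m + 1) κ'.toNNReal < t := exists_gt _
  have htm := ((le_max_left _ _).trans_lt ht).le
  have htκ : κ' < t := (Real.le_coe_toNNReal κ').trans_lt
    (NNReal.coe_lt_coe.2 ((le_max_right _ _).trans_lt ht))
  exact of_time (ξ.close η h.1 htm htm) (hκ.trans_lt htκ)
    ((h.2 t (ξ.close η h.1 htm htm) htκ).mono (out_anti x₀ hκ))

lemma loc (hκ : (m : ℝ) + 1 ≤ κ) (ζ : RaySpace x₀) :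
    ∃ U ∈ 𝓝 ζ, ∀ ξ ∈ U, ∀ η ∈ U, RayRel m κ ξ η := by
  obtain ⟨t, ht⟩ : ∃ t : ℝ≥0, (t : ℝ) = κ + 1 :=
    ⟨(κ + 1).toNNReal, Real.coe_toNNReal _ (by linarith [m_add_one_nonneg m])⟩
  refine ⟨{ξ | dist (ξ.1 t) (ζ.1 t) < 1 / 4},
    ((RaySpace.continuous_eval t).dist continuous_const).continuousAt.eventually_lt
      continuousAt_const (by simp), fun ξ hξ η hη => ?_⟩
  have hd := dist_triangle_right (ξ.1 t) (η.1 t) (ζ.1 t)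
  have h1 : dist (ξ.1 t) (ζ.1 t) < 1 / 4 := hξ
  have h2 : dist (η.1 t) (ζ.1 t) < 1 / 4 := hη
  obtain ⟨h, hrep⟩ := repIn_cls_of_dist_lt (x₀ := x₀) (x := ξ.1 t) (y := η.1 t) hκ
    (by rw [ξ.dist_apply]; linarith) (by linarith)
  exact of_time h (by linarith) hrep

end RayRel

end Rays

section RayTower

open CategoryTheory

variable {X : Type u} [MetricSpace X] [ProperSpace X] {x₀ : X}

lemma ProperlyHomotopic.exists_far {x₀ : X} {H : ℝ≥0 × I → X}
    (hH : ∀ K : Set X, IsCompact K → IsCompact (H ⁻¹' K)) (κ : ℝ) :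
    ∃ T : ℝ≥0, ∀ t, T ≤ t → ∀ s, H (t, s) ∈ out x₀ κ := by
  obtain ⟨T, hT⟩ := ((hH _ (isCompact_closedBall x₀ κ)).image continuous_fst).bddAbove
  refine ⟨T + 1, fun t ht s => ?_⟩
  by_contra h
  have h' : H (t, s) ∈ Metric.closedBall x₀ κ := by
    rw [Metric.mem_closedBall, dist_comm]
    exact not_lt.1 h
  exact absurd ((lt_add_one T).trans_le ht) (not_lt.2 (hT ⟨(t, s), h', rfl⟩))

variable [hX : Fact (IsCAT0Space X)] {m : ℝ≥0}

/-- A proper homotopy between two geodesic rays gives a class between them all of whose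
translates along the rays can be pushed out. -/
lemma RaySpace.exists_class {ξ η : RaySpace x₀} (h : ProperlyHomotopic ξ.1 η.1) :
    ∃ b : ob (out x₀ m) (ξ.1 (m + 1)) (mem_out_of_le (ξ.le_dist le_rfl)) ⟶
      ob (out x₀ m) (η.1 (m + 1)) (mem_out_of_le (η.le_dist le_rfl)),
      ∀ κ : ℝ, ∃ T₀ : ℝ≥0, ∀ T : ℝ≥0, T₀ ≤ T → ∀ hT : m + 1 ≤ T,
        ∃ a : ob (out x₀ m) (ξ.1 T) (mem_out_of_le (ξ.le_dist hT)) ⟶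
          ob (out x₀ m) (η.1 T) (mem_out_of_le (η.le_dist hT)),
          RepIn (out x₀ κ) a ∧
            b = (ξ.close_self le_rfl hT).cls ≫ a ≫ (η.close_self hT le_rfl).cls := by
  obtain ⟨H, hH, hHp, h0, h1⟩ := h
  let p : ∀ T, Path (ξ.1 T) (η.1 T) := fun T =>
    ⟨⟨fun s => H (T, s), by fun_prop⟩, h0 T, h1 T⟩
  obtain ⟨S₀, hS₀⟩ := ProperlyHomotopic.exists_far (x₀ := x₀) hHp m
  obtain ⟨S, hS, hmS⟩ : ∃ S, S₀ ≤ S ∧ m + 1 ≤ S :=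
    ⟨max S₀ (m + 1), le_max_left _ _, le_max_right _ _⟩
  refine ⟨(ξ.close_self le_rfl hmS).cls ≫ cls (p S) (fun s => hS₀ S hS s) ≫
    (η.close_self hmS le_rfl).cls, fun κ => ?_⟩
  obtain ⟨T₀, hT₀⟩ := ProperlyHomotopic.exists_far (x₀ := x₀) hHp κ
  refine ⟨max T₀ S, fun T hT hmT => ?_⟩
  have hT₁ := (le_max_left _ _).trans hT
  have hT₂ := hS.trans ((le_max_right _ _).trans hT)
  refine ⟨cls (p T) (fun s => hS₀ T hT₂ s), repIn_cls _ _ fun s => hT₀ T hT₁ s, ?_⟩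
  have hm : ∀ {t : ℝ≥0}, m + 1 ≤ t → (m : ℝ) < t := fun ht =>
    (lt_add_one (m : ℝ)).trans_le (by exact_mod_cast ht)
  have hseg : ∀ u : I, S₀ ≤ ((1 - u) * S + u * T : ℝ).toNNReal := fun u => by
    apply NNReal.le_toNNReal_of_coe_le
    have : (S₀ : ℝ) ≤ S := by exact_mod_cast hS
    have : (S₀ : ℝ) ≤ T := by exact_mod_cast hT₂
    nlinarith [u.2.1, u.2.2]
  have sq := cls_square (U := out x₀ m)
    (F := fun u v => H (((1 - u) * S + u * T : ℝ).toNNReal, v)) (by fun_prop)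
    (fun u v => hS₀ _ (hseg u) v) (p S) (η.seg S T) (ξ.seg S T) (p T)
    (fun t => by simp [p]) (fun t => h1 _) (fun t => h0 _) (fun t => by simp [p])
  rw [ξ.cls_seg (ξ.close_self hmS hmT), η.cls_seg (η.close_self hmS hmT)] at sq
  rw [← (ξ.close_self le_rfl hmS).cls_comp (ξ.close_self hmS hmT) (ξ.close_self le_rfl hmT),
    ← (η.close_self hmS hmT).cls_comp (η.close_self hmT le_rfl) (η.close_self hmS le_rfl)]
  simp only [Category.assoc]
  rw [reassoc_of% sq]

lemma RayRel.count (hgeo : ∀ ξ η : RaySpace x₀, ProperlyHomotopic ξ.1 η.1) (ζ : RaySpace x₀) :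
    ∃ code : RaySpace x₀ → ℕ, ∃ U ∈ 𝓝 ζ, ∀ ξ ∈ U, ∀ η ∈ U, code ξ = code η →
      ∀ κ : ℝ, RayRel m κ ξ η := by
  classical
  choose b hb using fun ξ => RaySpace.exists_class (m := m) (hgeo ζ ξ)
  obtain ⟨e, he⟩ := Countable.exists_injective_nat
    (ob (out x₀ m) (ζ.1 (m + 1)) (mem_out_of_le (ζ.le_dist le_rfl)) ⟶
      ob (out x₀ m) (ζ.1 (m + 1)) (mem_out_of_le (ζ.le_dist le_rfl)))
  refine ⟨fun ξ => if h : Close x₀ m (ξ.1 (m + 1)) (ζ.1 (m + 1)) then e (b ξ ≫ h.cls) else 0,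
    {ξ | dist (ξ.1 (m + 1)) (ζ.1 (m + 1)) < 1 / 2},
    ((RaySpace.continuous_eval _).dist continuous_const).continuousAt.eventually_lt
      continuousAt_const (by simp), fun ξ hξ η hη hcode κ => ?_⟩
  have hξ' : dist (ξ.1 (m + 1)) (ζ.1 (m + 1)) < 1 / 2 := hξ
  have hη' : dist (η.1 (m + 1)) (ζ.1 (m + 1)) < 1 / 2 := hη
  have hξζ : dist (ξ.1 (m + 1)) (ζ.1 (m + 1)) < 1 := by linarith
  have hηζ : dist (η.1 (m + 1)) (ζ.1 (m + 1)) < 1 := by linarith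
  have hξη : dist (ξ.1 (m + 1)) (η.1 (m + 1)) < 1 := by
    linarith [dist_triangle_right (ξ.1 (m + 1)) (η.1 (m + 1)) (ζ.1 (m + 1))]
  have cξ := ξ.close ζ hξζ (le_refl (m + 1)) le_rfl
  have cη := η.close ζ hηζ (le_refl (m + 1)) le_rfl
  simp only [dif_pos cξ, dif_pos cη] at hcode
  have hcode' := he hcode
  obtain ⟨T₁, hT₁⟩ := hb ξ κ
  obtain ⟨T₂, hT₂⟩ := hb η κ
  obtain ⟨T, hT⟩ : ∃ T : ℝ≥0, max (max T₁ T₂) (max (m + 1) κ.toNNReal) < T := exists_gt _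
  simp only [max_lt_iff] at hT
  obtain ⟨⟨hT1, hT2⟩, hmT, hκT⟩ := hT
  have hκ : κ < T := (Real.le_coe_toNNReal κ).trans_lt (NNReal.coe_lt_coe.2 hκT)
  obtain ⟨a, ha, hba⟩ := hT₁ T hT1.le hmT.le
  obtain ⟨a', ha', hba'⟩ := hT₂ T hT2.le hmT.le
  have d := ξ.close η hξη hmT.le hmT.le
  refine RayRel.of_time d hκ ?_
  have dξ := ξ.close ζ hξζ hmT.le le_rfl
  have dη := η.close ζ hηζ hmT.le le_rfl
  rw [hba, hba'] at hcode'
  simp only [Category.assoc, cancel_epi] at hcode'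
  rw [(ξ.close_self hmT.le le_rfl).cls_comp cξ dξ,
    (η.close_self hmT.le le_rfl).cls_comp cη dη] at hcode'
  have key : d.cls = inv a ≫ a' := by
    rw [IsIso.eq_inv_comp, ← cancel_mono dη.cls, Category.assoc, d.cls_comp dη dξ]
    exact hcode'
  rw [key]
  exact ha.inv.comp ha'

lemma RayRel.countableTower (hgeo : ∀ ξ η : RaySpace x₀, ProperlyHomotopic ξ.1 η.1) :
    CountableTower (RaySpace x₀) (fun k => RayRel m (m + 1 + k))
      {z | dist (z.1.1 (m + 1)) (z.2.1 (m + 1)) < 1} where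
  mem_uniformity := by
    have : UniformContinuous fun ξ : RaySpace x₀ => ξ.1 (m + 1) :=
      (Pi.uniformContinuous_proj _ _).comp uniformContinuous_subtype_val
    exact this (Metric.dist_mem_uniformity one_pos)
  refl _ ξ := RayRel.refl ξ
  symm _ _ _ h := h.symm
  trans _ _ _ _ hV h₁ h₂ := RayRel.trans hV h₁ h₂
  anti j k _ _ hjk h := h.anti (by have : (j : ℝ) ≤ k := by exact_mod_cast hjk
                                   linarith)
  loc k ζ := RayRel.loc (by linarith [(Nat.cast_nonneg k : (0 : ℝ) ≤ k)]) ζ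
  count ζ := by
    obtain ⟨code, U, hU, h⟩ := RayRel.count (m := m) hgeo ζ
    exact ⟨code, U, hU, fun ξ hξ η hη e k => h ξ hξ η hη e _⟩

end RayTower

section RayLimits

variable {X : Type u} [MetricSpace X] [ProperSpace X] {x₀ : X} [hX : Fact (IsCAT0Space X)]

/-- Points far away from `x₀` project close to points on geodesic rays. -/
lemma RaySpace.exists_near (x₀ : X) (s : ℝ≥0) {ε : ℝ} (hε : 0 < ε) :
    ∃ R : ℝ≥0, s ≤ R ∧ ∀ x, (R : ℝ) ≤ dist x₀ x →
      ∃ ξ : RaySpace x₀, dist (proj x₀ x s) (ξ.1 s) < ε := by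
  by_contra! hcon
  choose x hx hfar using fun n : ℕ => hcon (max s n) (le_max_left _ _)
  have hr : ∀ t : ℝ, ∀ᶠ n in hyperfilter ℕ, t ≤ dist x₀ (x n) := fun t => by
    refine Nat.hyperfilter_le_atTop ?_
    filter_upwards [eventually_ge_atTop ⌈t⌉₊] with n hn
    have h1 : (n : ℝ) ≤ ((max s n : ℝ≥0) : ℝ) := by
      rw [NNReal.coe_max]
      exact (le_max_right _ _)
    exact (Nat.ceil_le.1 hn).trans (h1.trans (hx n))
  have hlim : ∀ t : ℝ≥0, ∃ z, Tendsto (fun n => proj x₀ (x n) t) (hyperfilter ℕ) (𝓝 z) := by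
    intro t
    obtain ⟨z, -, hz⟩ := (isCompact_closedBall x₀ (t : ℝ)).ultrafilter_le_nhds
      ((hyperfilter ℕ).map fun n => proj x₀ (x n) t) (by
        rw [Ultrafilter.coe_map, le_principal_iff, mem_map]
        filter_upwards [hr t] with n hn
        rw [mem_preimage, Metric.mem_closedBall, dist_comm]
        exact (dist_proj t.2 hn).le)
    exact ⟨z, hz⟩
  choose ξ hξ using hlim
  have hξ' : ξ 0 = x₀ ∧ ∀ s t, dist (ξ s) (ξ t) = |(s : ℝ) - t| := by
    refine ⟨tendsto_nhds_unique (hξ 0) ?_, fun s t => ?_⟩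
    · simp [proj]
    · refine tendsto_nhds_unique ((hξ s).dist (hξ t)) (tendsto_const_nhds.congr' ?_)
      filter_upwards [hr s, hr t] with n hs ht
      exact (dist_proj_proj_self ⟨s.2, hs⟩ ⟨t.2, ht⟩).symm
  have h0 := (hξ s).dist (tendsto_const_nhds (x := ξ s))
  rw [dist_self] at h0
  obtain ⟨n, hn⟩ := (h0.eventually (gt_mem_nhds hε)).exists
  exact absurd hn (not_lt.2 (hfar n ⟨ξ, hξ'⟩))

lemma RaySpace.exists_uniform {W : Set (RaySpace x₀ × RaySpace x₀)} (hW : ∀ ξ, W ∈ 𝓝 (ξ, ξ))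
    (n₁ : ℝ≥0) : ∃ n : ℝ≥0, n₁ ≤ n ∧ ∃ ε : ℝ, 0 < ε ∧ ε ≤ 1 ∧
      ∀ ξ η : RaySpace x₀, dist (ξ.1 n) (η.1 n) < ε → (ξ, η) ∈ W := by
  by_contra! hcon
  choose ξ η hd hW' using fun n : ℕ => hcon (n₁ + n) le_self_add (1 / ((n : ℝ) + 1))
    Nat.one_div_pos_of_nat ((div_le_one (by positivity)).2 (by linarith [n.cast_nonneg (α := ℝ)]))
  obtain ⟨⟨a, b⟩, -, hab⟩ := isCompact_univ.ultrafilter_le_nhds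
    ((hyperfilter ℕ).map fun n => (ξ n, η n)) (by simp)
  have hab' : Tendsto (fun n => (ξ n, η n)) (hyperfilter ℕ) (𝓝 (a, b)) := hab
  have ha := (continuous_fst.tendsto (a, b)).comp hab'
  have hb := (continuous_snd.tendsto (a, b)).comp hab'
  obtain rfl : a = b := by
    refine Subtype.ext (funext fun t => dist_le_zero.1 ?_)
    have h1 := (((continuous_eval t).tendsto a).comp ha).dist
      (((continuous_eval t).tendsto b).comp hb)
    have h2 : Tendsto (fun n : ℕ => 1 / ((n : ℝ) + 1)) (hyperfilter ℕ) (𝓝 0) :=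
      tendsto_one_div_add_atTop_nhds_zero_nat.mono_left Nat.hyperfilter_le_atTop
    refine le_of_tendsto_of_tendsto h1 h2 (Nat.hyperfilter_le_atTop ?_)
    filter_upwards [eventually_ge_atTop ⌈t⌉₊] with n hn
    refine ((ξ n).dist_apply_mono (η n) ?_).trans (hd n).le
    exact (Nat.ceil_le.1 hn).trans le_add_self
  obtain ⟨n, hn⟩ := (hab'.eventually (hW a)).exists
  exact hW' n hn

lemma RaySpace.preconnectedSpace (hone : HasOneEnd X) : PreconnectedSpace (RaySpace x₀) := by
  rw [preconnectedSpace_iff_clopen]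
  intro A hA
  by_contra! hne
  obtain ⟨⟨ξ, hξ⟩, hne'⟩ := hne
  obtain ⟨η, hη⟩ := (ne_univ_iff_exists_notMem A).1 hne'
  obtain ⟨n, -, ε, hε, -, hn⟩ := RaySpace.exists_uniform (x₀ := x₀)
    (W := {z | z.1 ∈ A ↔ z.2 ∈ A}) (fun ζ => by
      by_cases hζ : ζ ∈ A
      · filter_upwards [prod_mem_nhds (hA.isOpen.mem_nhds hζ) (hA.isOpen.mem_nhds hζ)] with z hz
        exact ⟨fun _ => hz.2, fun _ => hz.1⟩
      · filter_upwards [prod_mem_nhds (hA.compl.isOpen.mem_nhds hζ)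
          (hA.compl.isOpen.mem_nhds hζ)] with z hz
        exact ⟨fun h => absurd h hz.1, fun h => absurd h hz.2⟩) 0
  obtain ⟨R, hnR, hR⟩ := RaySpace.exists_near x₀ n (half_pos hε)
  have hnR' : (n : ℝ) ≤ R := NNReal.coe_le_coe.2 hnR
  let S : Set (RaySpace x₀) → Set X := fun B =>
    {z | (R : ℝ) < dist x₀ z ∧ ∃ ξ ∈ B, dist (proj x₀ z n) (ξ.1 n) < ε / 2}
  have hproj : ContinuousOn (fun z => proj x₀ z n) {z | (R : ℝ) < dist x₀ z} :=
    (LipschitzOnWith.of_dist_le_mul (K := 2) fun z hz w hw =>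
      dist_proj_le_two_mul n.2 (hnR'.trans (le_of_lt hz)) (hnR'.trans (le_of_lt hw))).continuousOn
  have hS : ∀ B, IsOpen (S B) := fun B => by
    have : S B = ⋃ ξ ∈ B, {z | (R : ℝ) < dist x₀ z} ∩
        (fun z => dist (proj x₀ z n) (ξ.1 n)) ⁻¹' Iio (ε / 2) := by
      ext z
      simp only [S, mem_ofPred_eq, mem_iUnion, mem_inter_iff, mem_preimage, mem_Iio]
      constructor
      · rintro ⟨h, ξ, hξ, hd⟩
        exact ⟨ξ, hξ, h, hd⟩
      · rintro ⟨ξ, hξ, h, hd⟩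
        exact ⟨h, ξ, hξ, hd⟩
    rw [this]
    refine isOpen_biUnion fun ξ _ => ContinuousOn.isOpen_inter_preimage
      (fun z hz => (hproj z hz).dist tendsto_const_nhds)
      (isOpen_lt continuous_const (continuous_const.dist continuous_id)) isOpen_Iio
  obtain ⟨K', hK', -, hconn⟩ := hone.2 (Metric.closedBall x₀ R) (isCompact_closedBall _ _)
  obtain ⟨T, hT⟩ := hK'.isBounded.subset_closedBall x₀
  obtain ⟨t, ht⟩ : ∃ t : ℝ≥0, max R T.toNNReal < t := exists_gt _
  have htR : (R : ℝ) < t := NNReal.coe_lt_coe.2 ((le_max_left _ _).trans_lt ht)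
  have htT : T < t := (Real.le_coe_toNNReal T).trans_lt
    (NNReal.coe_lt_coe.2 ((le_max_right _ _).trans_lt ht))
  have hout : ∀ ζ : RaySpace x₀, ζ.1 t ∉ K' := fun ζ h => by
    have := hT h
    rw [Metric.mem_closedBall, dist_comm, ζ.dist_apply] at this
    linarith
  have hmem : ∀ ζ : RaySpace x₀, ζ.1 t ∈ (Metric.closedBall x₀ (R : ℝ))ᶜ := fun ζ h => by
    rw [Metric.mem_closedBall, dist_comm, ζ.dist_apply] at h
    linarith
  have hSmem : ∀ (B : Set (RaySpace x₀)) (ζ), ζ ∈ B → ζ.1 t ∈ S B := fun B ζ hζ =>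
    ⟨(ζ.dist_apply t).symm ▸ htR, ζ, hζ, by
      rw [ζ.proj_apply (hnR.trans (NNReal.coe_lt_coe.1 htR).le), dist_self]
      positivity⟩
  have hpre := isPreconnected_connectedComponentIn (x := ξ.1 t)
    (F := (Metric.closedBall x₀ (R : ℝ))ᶜ)
  have hηc : η.1 t ∈ connectedComponentIn (Metric.closedBall x₀ (R : ℝ))ᶜ (ξ.1 t) := by
    rw [hconn _ (hout ξ) _ (hout η)]
    exact mem_connectedComponentIn (hmem η)
  obtain ⟨z, -, ⟨-, a, ha, had⟩, -, b, hb, hbd⟩ := hpre (S A) (S Aᶜ) (hS _) (hS _) (fun z hz => by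
    have hz' : (R : ℝ) < dist x₀ z := by
      have := connectedComponentIn_subset _ _ hz
      rwa [mem_compl_iff, Metric.mem_closedBall, dist_comm, not_le] at this
    obtain ⟨ζ, hζ⟩ := hR z hz'.le
    by_cases h : ζ ∈ A
    · exact Or.inl ⟨hz', ζ, h, hζ⟩
    · exact Or.inr ⟨hz', ζ, h, hζ⟩) ⟨_, mem_connectedComponentIn (hmem ξ), hSmem A ξ hξ⟩
    ⟨_, hηc, hSmem _ η hη⟩
  refine hb ((hn a b ?_).1 ha)
  linarith [dist_triangle_left (a.1 n) (b.1 n) (proj x₀ z n)]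

/-- The radial classes between rays that are sufficiently close can be pushed out of every
ball. -/
lemma RayRel.exists_uniform (hone : HasOneEnd X)
    (hgeo : ∀ ξ η : RaySpace x₀, ProperlyHomotopic ξ.1 η.1) (m : ℝ≥0) :
    ∃ n : ℝ≥0, m + 1 ≤ n ∧ ∃ ε : ℝ, 0 < ε ∧ ε ≤ 1 ∧
      ∀ ξ η : RaySpace x₀, dist (ξ.1 n) (η.1 n) < ε → ∀ κ : ℝ, RayRel m κ ξ η := by
  have := RaySpace.preconnectedSpace (x₀ := x₀) hone
  obtain ⟨n, hn, ε, hε, hε1, h⟩ := RaySpace.exists_uniform (x₀ := x₀)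
    (W := {z | ∀ k : ℕ, RayRel m (m + 1 + k) z.1 z.2}) (fun ζ => by
      obtain ⟨U, hU, h⟩ := (RayRel.countableTower hgeo).flatAt_univ (E := fun k => RayRel m _) ζ
      filter_upwards [prod_mem_nhds hU hU] with z hz
      exact h _ hz.1 _ hz.2) (m + 1)
  refine ⟨n, hn, ε, hε, hε1, fun ξ η hd κ => ?_⟩
  obtain ⟨k, hk⟩ := exists_nat_ge κ
  exact (h ξ η hd k).anti (by linarith [m_add_one_nonneg m])

end RayLimits

section PushingOut

open CategoryTheory

variable {X : Type u} [MetricSpace X] [ProperSpace X] {x₀ : X}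

lemma exists_mem_out (hone : HasOneEnd X) (x₀ : X) (κ : ℝ) : ∃ x, x ∈ out x₀ κ := by
  by_contra! h
  refine hone.1 ((isCompact_closedBall x₀ κ).of_isClosed_subset isClosed_univ fun x _ => ?_)
  rw [Metric.mem_closedBall, dist_comm]
  exact not_lt.1 (h x)

variable [hX : Fact (IsCAT0Space X)]

/-- Semistability in terms of paths: paths far from `x₀` whose endpoints are very far can be
pushed out relative to their endpoints. -/
theorem exists_repIn_out (hone : HasOneEnd X)
    (hgeo : ∀ ξ η : RaySpace x₀, ProperlyHomotopic ξ.1 η.1) (m : ℝ≥0) :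
    ∃ R : ℝ, m ≤ R ∧ ∀ κ : ℝ, ∃ R' : ℝ, ∀ (x y : X) (p : Path x y), (∀ t, p t ∈ out x₀ R) →
      x ∈ out x₀ R' → y ∈ out x₀ R' → ∀ h : ∀ t, p t ∈ out x₀ m, RepIn (out x₀ κ) (cls p h) := by
  obtain ⟨n, hmn, ε, hε, hε1, hn⟩ := RayRel.exists_uniform hone hgeo m
  have hmn' : (m : ℝ) + 1 ≤ n := by exact_mod_cast hmn
  obtain ⟨R, hnR, hR⟩ := RaySpace.exists_near x₀ n (ε := ε / 4) (by positivity)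
  have hnR' : (n : ℝ) ≤ R := NNReal.coe_le_coe.2 hnR
  refine ⟨R, by linarith, fun κ₀ => ?_⟩
  obtain ⟨κ, hκ₀, hmκ⟩ : ∃ κ : ℝ, κ₀ ≤ κ ∧ (m : ℝ) + 1 ≤ κ :=
    ⟨max κ₀ (m + 1), le_max_left _ _, le_max_right _ _⟩
  obtain ⟨T, hκT, hnT⟩ : ∃ T : ℝ≥0, κ + 1 / 2 ≤ T ∧ n ≤ T :=
    ⟨max (κ + 1 / 2).toNNReal n, (Real.le_coe_toNNReal _).trans
      (NNReal.coe_le_coe.2 (le_max_left _ _)), le_max_right _ _⟩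
  have hnT' : (n : ℝ) ≤ T := NNReal.coe_le_coe.2 hnT
  have hmT : m + 1 ≤ T := hmn.trans hnT
  have hκT' : κ < T := by linarith
  have : Nonempty (RaySpace x₀) := by
    obtain ⟨x, hx⟩ := exists_mem_out hone x₀ R
    exact ⟨(hR x (le_of_lt hx)).choose⟩
  choose! q hq using hR
  obtain ⟨R', hTR', hR'⟩ := RaySpace.exists_near x₀ T (ε := ε / 4) (by positivity)
  have hTR'' : (T : ℝ) ≤ R' := NNReal.coe_le_coe.2 hTR'
  have close_q : ∀ x, (R : ℝ) ≤ dist x₀ x → ∀ ξ : RaySpace x₀,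
      dist (proj x₀ x n) (ξ.1 n) < ε / 4 → Close x₀ m x (ξ.1 T) := fun x hx ξ hξ => by
    refine ⟨by linarith, ξ.le_dist hmT, ?_⟩
    have h1 := dist_proj_le (x₀ := x₀) (x := x) (y := ξ.1 T) (m_add_one_nonneg m) hmn'
      (hnR'.trans hx) (hnT'.trans (ξ.dist_apply T).ge)
    rw [ξ.proj_apply hnT] at h1
    linarith
  let Q : ∀ ⦃a b : FundamentalGroupoid (out x₀ m)⦄, (a ⟶ b) → Prop := fun a b f =>
    ∃ (ha : Close x₀ m a.as.1 ((q a.as.1).1 T)) (hb : Close x₀ m b.as.1 ((q b.as.1).1 T))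
      (α : ob (out x₀ m) ((q a.as.1).1 T) (mem_out_of_le ha.right) ⟶
        ob (out x₀ m) ((q b.as.1).1 T) (mem_out_of_le hb.right)),
      RepIn (out x₀ κ) α ∧ f = ha.cls ≫ α ≫ inv hb.cls
  have hQ : ∀ {x y : X} (p : Path x y), (∀ t, p t ∈ out x₀ R) →
      ∀ h : ∀ t, p t ∈ out x₀ m, Q (cls p h) := by
    intro x y p hpR h
    refine cls_induction (Q := Q) (V := out x₀ R) ?_ (fun z hz => ?_) p hpR h
    · rintro a b c f g ⟨ha, hb, α, hα, rfl⟩ ⟨hb', hc, β, hβ, rfl⟩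
      refine ⟨ha, hc, α ≫ β, hα.comp hβ, ?_⟩
      simp only [Category.assoc, IsIso.inv_hom_id_assoc]
    · refine ⟨Metric.ball z (ε / 8), Metric.ball_mem_nhds _ (by positivity), ?_⟩
      intro w p h hW hV
      have hzR : (R : ℝ) < dist x₀ z := hz
      have hpz : ∀ t, dist z (p t) < ε / 8 := fun t => by
        have := hW t
        rwa [Metric.mem_ball, dist_comm] at this
      have hwR : (R : ℝ) < dist x₀ w := by
        have : w ∈ out x₀ R := by simpa using hV 1
        exact this
      have hzw : dist z w < ε / 8 := by simpa using hpz 1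
      have hcl : ∀ t, Close x₀ m z (p t) := fun t => by
        have hp : (R : ℝ) < dist x₀ (p t) := hV t
        refine ⟨by linarith, by linarith, ?_⟩
        refine (dist_proj_le_two_mul (m_add_one_nonneg m) (by linarith) (by linarith)).trans_lt ?_
        linarith [hpz t]
      have czw : Close x₀ m z w := by simpa using hcl 1
      have cz := close_q z hzR.le (q z) (hq z hzR.le)
      have cw := close_q w hwR.le (q w) (hq w hwR.le)
      have hqq : RayRel m κ (q z) (q w) := by
        refine hn _ _ ?_ κ
        have h1 := dist_proj_le_two_mul (x₀ := x₀) (x := z) (y := w) n.2 (hnR'.trans hzR.le)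
          (hnR'.trans hwR.le)
        have h2 := hq z hzR.le
        have h3 := hq w hwR.le
        rw [NNReal.val_eq_coe] at h1
        have h4 := dist_triangle4 ((q z).1 n) (proj x₀ z n) (proj x₀ w n) ((q w).1 n)
        rw [dist_comm ((q z).1 n) (proj x₀ z n)] at h4
        linarith
      have cq := (q z).close (q w) hqq.1 hmT hmT
      have key : Q (cls p h) := by
        refine ⟨cz, cw, cq.cls, hqq.2 T cq hκT', ?_⟩
        have hc : Close x₀ m z ((q w).1 T) := ⟨cz.left, cw.right, by
          have := cz.near
          have h1 := dist_proj_le (x₀ := x₀) (x := z) (y := (q w).1 T) (m_add_one_nonneg m) hmn'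
            (hnR'.trans hzR.le) (hnT'.trans ((q w).dist_apply T).ge)
          rw [(q w).proj_apply hnT] at h1
          have h2 := dist_proj_le_two_mul (x₀ := x₀) (x := z) (y := w) n.2 (hnR'.trans hzR.le)
            (hnR'.trans hwR.le)
          rw [NNReal.val_eq_coe] at h2
          have h3 := hq w hwR.le
          linarith [dist_triangle (proj x₀ z n) (proj x₀ w n) ((q w).1 n)]⟩
        rw [cls_eq_close_cls p hcl czw, ← Category.assoc, cz.cls_comp cq hc,
          IsIso.eq_comp_inv]
        exact czw.cls_comp cw hc
      refine ⟨key, ?_⟩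
      obtain ⟨h1, h2, α, hα, he⟩ := key
      refine ⟨h2, h1, inv α, hα.inv, ?_⟩
      rw [he]
      simp only [IsIso.inv_comp, IsIso.inv_inv, Category.assoc]
  have hend : ∀ x ∈ out x₀ (max R R'), ∀ h : Close x₀ m x ((q x).1 T),
      RepIn (out x₀ κ) h.cls := by
    intro x hx h
    have hx' : max (R : ℝ) R' < dist x₀ x := hx
    obtain ⟨hxR, hxR'⟩ := max_lt_iff.1 hx'
    obtain ⟨ξ, hξ⟩ := hR' x hxR'.le
    have hTx : (T : ℝ) ≤ dist x₀ x := hTR''.trans hxR'.le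
    have hrp := dist_proj (x₀ := x₀) (x := x) T.2 hTx
    rw [NNReal.val_eq_coe] at hrp
    have hξn : dist (proj x₀ x n) (ξ.1 n) < ε / 4 := by
      have := dist_proj_le (x₀ := x₀) (x := x) (y := ξ.1 T) n.2 hnT' hTx (ξ.dist_apply T).ge
      rw [NNReal.val_eq_coe, ξ.proj_apply hnT, ξ.proj_apply le_rfl] at this
      linarith
    have cξ := close_q x hxR.le ξ hξn
    have hξq : RayRel m κ ξ (q x) := by
      refine hn _ _ ?_ κ
      linarith [dist_triangle_left (ξ.1 n) ((q x).1 n) (proj x₀ x n), hq x hxR.le]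
    have cq := ξ.close (q x) hξq.1 hmT hmT
    obtain ⟨c₁, h₁⟩ := repIn_cls_of_dist_lt (x₀ := x₀) (m := m) (κ := κ) (x := proj x₀ x T)
      (y := ξ.1 T) hmκ (by rw [hrp]; exact hκT) (by linarith)
    have hrad : ∀ t, T ≤ dist x₀ (radPath x₀ x T t) ∧ Close x₀ m x (radPath x₀ x T t) := by
      intro t
      obtain ⟨h2, h3⟩ := dist_radPath T.2 hTx t
      rw [NNReal.val_eq_coe] at h2 h3
      have hle : (m : ℝ) + 1 ≤ dist x₀ (radPath x₀ x T t) := by linarith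
      refine ⟨by linarith, h.left, hle, ?_⟩
      rw [radPath_apply, proj_proj (m_add_one_nonneg m) (by linarith)
        (by nlinarith [t.2.1, t.2.2]), dist_self]
      exact one_pos
    have c₀ : Close x₀ m x (proj x₀ x T) := by simpa using (hrad 1).2
    rw [← cξ.cls_comp cq h, ← c₀.cls_comp c₁ cξ, ← cls_eq_close_cls _ (fun t => (hrad t).2) c₀]
    have hκrad : ∀ t, radPath x₀ x T t ∈ out x₀ κ := fun t => hκT'.trans_le (hrad t).1
    exact ((repIn_cls _ _ hκrad).comp h₁).comp (hξq.2 T cq hκT')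
  refine ⟨max R R', fun x y p hpR hx hy h => ?_⟩
  obtain ⟨ha, hb, α, hα, he⟩ := hQ p hpR h
  rw [he]
  exact ((hend x hx ha).comp (hα.comp (hend y hy hb).inv)).mono (out_anti x₀ hκ₀)

end PushingOut

/-- Homotopies parametrized by the unit intervals `[j, j + 1]` can be concatenated. -/
lemma continuous_glue {Y Z : Type*} [TopologicalSpace Y] [TopologicalSpace Z] {f : ℕ → ℝ → Y → Z}
    (hf : ∀ j, Continuous fun p : ℝ × Y => f j p.1 p.2) (h : ∀ j y, f j 1 y = f (j + 1) 0 y) :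
    Continuous fun z : ℝ≥0 × Y => f ⌊z.1⌋₊ ((z.1 : ℝ) - ⌊z.1⌋₊) z.2 := by
  have hlf : LocallyFinite fun j : ℕ => {z : ℝ≥0 × Y | z.1 ∈ Icc (j : ℝ≥0) (j + 1)} := by
    intro z
    refine ⟨Prod.fst ⁻¹' Iio (z.1 + 1), (isOpen_Iio.preimage continuous_fst).mem_nhds
      (lt_add_one z.1), (finite_Iic ⌊z.1 + 1⌋₊).subset ?_⟩
    rintro j ⟨w, hw, hwz⟩
    exact Nat.le_floor (hw.1.trans (le_of_lt hwz))
  refine hlf.continuous (iUnion_eq_univ_iff.2 fun z =>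
    ⟨⌊z.1⌋₊, Nat.floor_le zero_le, (Nat.lt_floor_add_one _).le⟩)
    (fun j => isClosed_Icc.preimage continuous_fst) fun j => ?_
  have : ContinuousOn (fun z : ℝ≥0 × Y => f j ((z.1 : ℝ) - j) z.2)
      {z : ℝ≥0 × Y | z.1 ∈ Icc (j : ℝ≥0) (j + 1)} :=
    ((hf j).comp (by fun_prop : Continuous fun z : ℝ≥0 × Y => ((z.1 : ℝ) - j, z.2))).continuousOn
  refine this.congr fun z hz => ?_
  rcases hz.2.eq_or_lt with h1 | h1
  · have : ⌊z.1⌋₊ = j + 1 := by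
      rw [h1]; exact_mod_cast Nat.floor_natCast (R := ℝ≥0) (j + 1)
    dsimp only
    rw [this, h1]
    push_cast
    rw [sub_self, add_sub_cancel_left, h]
  · have : ⌊z.1⌋₊ = j := (Nat.floor_eq_iff zero_le).2 ⟨hz.1, h1⟩
    rw [this]

section ProperHomotopies

variable {X : Type u} [MetricSpace X]

lemma ProperlyHomotopic.symm {c c' : ℝ≥0 → X} (h : ProperlyHomotopic c c') :
    ProperlyHomotopic c' c := by
  obtain ⟨H, hH, hp, h0, h1⟩ := h
  let e : ℝ≥0 × I ≃ₜ ℝ≥0 × I :=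
    { toFun := fun z => (z.1, σ z.2)
      invFun := fun z => (z.1, σ z.2)
      left_inv := fun z => by simp
      right_inv := fun z => by simp }
  refine ⟨H ∘ e, hH.comp e.continuous, fun K hK => ?_, fun t => by simp [e, h1],
    fun t => by simp [e, h0]⟩
  rw [preimage_comp]
  exact e.isCompact_preimage.2 (hp K hK)

lemma isCompact_preimage_of_far [ProperSpace X] {x₀ : X} {H : ℝ≥0 × I → X} (hH : Continuous H)
    (hfar : ∀ κ : ℝ, ∃ T : ℝ≥0, ∀ t, T ≤ t → ∀ s, H (t, s) ∈ out x₀ κ) (K : Set X)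
    (hK : IsCompact K) : IsCompact (H ⁻¹' K) := by
  obtain ⟨κ, hκ⟩ := hK.isBounded.subset_closedBall x₀
  obtain ⟨T, hT⟩ := hfar κ
  refine ((isCompact_Icc (a := 0) (b := T)).prod isCompact_univ).of_isClosed_subset
    (hK.isClosed.preimage hH) fun z hz => ⟨⟨zero_le, ?_⟩, mem_univ _⟩
  by_contra hlt
  have h1 : κ < dist x₀ (H z) := hT z.1 (not_le.1 hlt).le z.2
  have h2 := Metric.mem_closedBall'.1 (hκ hz)
  linarith

variable [ProperSpace X]

lemma ProperRay.exists_far (c : ProperRay X) (x₀ : X) (κ : ℝ) :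
    ∃ T : ℝ≥0, ∀ t, T ≤ t → c.toFun t ∈ out x₀ κ := by
  obtain ⟨T, hT⟩ := ProperlyHomotopic.exists_far (x₀ := x₀) (H := fun z => c.toFun z.1)
    (fun K hK => ((c.isProper K hK).prod isCompact_univ).of_isClosed_subset
      (hK.isClosed.preimage (c.continuous_toFun.comp continuous_fst))
        fun z hz => ⟨hz, mem_univ _⟩) κ
  exact ⟨T, fun t ht => hT t ht 0⟩

lemma ProperlyHomotopic.trans {a b c : ℝ≥0 → X} (h : ProperlyHomotopic a b)
    (h' : ProperlyHomotopic b c) : ProperlyHomotopic a c := by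
  obtain ⟨H, hH, hp, h0, h1⟩ := h
  obtain ⟨H', hH', hp', h0', h1'⟩ := h'
  have hc : Continuous fun z : ℝ≥0 × I => if (z.2 : ℝ) ≤ 1 / 2
      then H (z.1, projIcc 0 1 zero_le_one (2 * (z.2 : ℝ)))
      else H' (z.1, projIcc 0 1 zero_le_one (2 * (z.2 : ℝ) - 1)) := by
    refine Continuous.if_le (by fun_prop) (by fun_prop) (by fun_prop) (by fun_prop) fun z hz => ?_
    rw [hz]
    norm_num
    exact (h1 _).trans (h0' _).symm
  refine ⟨_, hc, isCompact_preimage_of_far (x₀ := H (0, 0)) hc fun κ => ?_,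
    fun t => ?_, fun t => ?_⟩
  · obtain ⟨T, hT⟩ := ProperlyHomotopic.exists_far (x₀ := H (0, 0)) hp κ
    obtain ⟨T', hT'⟩ := ProperlyHomotopic.exists_far (x₀ := H (0, 0)) hp' κ
    refine ⟨max T T', fun t ht s => ?_⟩
    dsimp only
    split_ifs
    · exact hT t ((le_max_left _ _).trans ht) _
    · exact hT' t ((le_max_right _ _).trans ht) _
  · simp [h0]
  · norm_num [h1']

lemma ProperRay.properlyHomotopic_comp (c : ProperRay X) {φ : ℝ≥0 → ℝ≥0} (hφ : Continuous φ)
    (hle : ∀ t, t ≤ φ t + 1) : ProperlyHomotopic c.toFun (c.toFun ∘ φ) := by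
  have hc : Continuous fun z : ℝ≥0 × I =>
      c.toFun (Real.toNNReal ((1 - z.2) * (z.1 : ℝ) + z.2 * (φ z.1 : ℝ))) :=
    c.continuous_toFun.comp (by fun_prop)
  refine ⟨_, hc, isCompact_preimage_of_far (x₀ := c.toFun 0) hc fun κ => ?_, fun t => by simp,
    fun t => by simp⟩
  obtain ⟨T, hT⟩ := c.exists_far (c.toFun 0) κ
  refine ⟨T + 1, fun t ht s => hT _ ?_⟩
  have h1 : (T : ℝ) + 1 ≤ t := by exact_mod_cast ht
  have h2 : (t : ℝ) ≤ φ t + 1 := by exact_mod_cast hle t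
  refine NNReal.le_toNNReal_of_coe_le ?_
  nlinarith [s.2.1, s.2.2]

end ProperHomotopies

section Flare

variable {X : Type u} [TopologicalSpace X] {c c' : ℝ → X} {t : ℝ}

/-- A path joining two rays, extended along these rays to a bi-infinite curve. -/
noncomputable def flareExt (q : Path (c t) (c' t)) (s : ℝ) : X :=
  if s ≤ 0 then c (t - s) else if s ≤ 1 then q.extend s else c' (t + (s - 1))

lemma continuous_flareExt (hc : Continuous c) (hc' : Continuous c') (q : Path (c t) (c' t)) :
    Continuous (flareExt q) := by
  refine Continuous.if_le (by fun_prop) (Continuous.if_le (by fun_prop) (by fun_prop)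
    continuous_id continuous_const ?_) continuous_id continuous_const ?_
  · rintro s rfl
    simp
  · rintro s rfl
    simp

lemma flareExt_of_nonpos (q : Path (c t) (c' t)) {s : ℝ} (hs : s ≤ 0) :
    flareExt q s = c (t - s) := if_pos hs

lemma flareExt_of_one_le (q : Path (c t) (c' t)) {s : ℝ} (hs : 1 ≤ s) :
    flareExt q s = c' (t + (s - 1)) := by
  rw [flareExt, if_neg (by linarith)]
  split_ifs with h
  · obtain rfl := le_antisymm h hs
    simp
  · rfl

lemma flareExt_coe (q : Path (c t) (c' t)) (s : I) : flareExt q s = q s := by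
  rw [flareExt, if_pos s.2.2, Path.extend_apply _ s.2]
  split_ifs with h
  · obtain rfl : s = 0 := le_antisymm h s.2.1
    simp
  · rfl

lemma flareExt_mem {V : Set X} {q : Path (c t) (c' t)} (hq : ∀ s, q s ∈ V)
    (hc : ∀ u, t ≤ u → c u ∈ V) (hc' : ∀ u, t ≤ u → c' u ∈ V) (s : ℝ) : flareExt q s ∈ V := by
  rw [flareExt]
  split_ifs with h h'
  · exact hc _ (by linarith)
  · rw [Path.extend_apply _ ⟨(not_le.1 h).le, h'⟩]
    exact hq _
  · exact hc' _ (by linarith)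

/-- The path which starts at distance `δ` further out on the first ray, comes back, follows `q`,
and goes out to distance `δ` on the second ray. -/
noncomputable def flarePath (hc : Continuous c) (hc' : Continuous c') (q : Path (c t) (c' t))
    {δ : ℝ} (hδ : 0 ≤ δ) : Path (c (t + δ)) (c' (t + δ)) where
  toFun s := flareExt q (s + δ * (2 * s - 1))
  continuous_toFun := (continuous_flareExt hc hc' q).comp (by fun_prop)
  source' := by
    rw [flareExt_of_nonpos] <;> simp [hδ]
  target' := by
    rw [flareExt_of_one_le] <;> norm_num [hδ]

lemma flarePath_apply (hc : Continuous c) (hc' : Continuous c') (q : Path (c t) (c' t))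
    {δ : ℝ} (hδ : 0 ≤ δ) (s : I) :
    flarePath hc hc' q hδ s = flareExt q (s + δ * (2 * s - 1)) := rfl

lemma flarePath_mem {V : Set X} {q : Path (c t) (c' t)} (hq : ∀ s, q s ∈ V)
    (hc : ∀ u, t ≤ u → c u ∈ V) (hc' : ∀ u, t ≤ u → c' u ∈ V) (hcc : Continuous c)
    (hcc' : Continuous c') {δ : ℝ} (hδ : 0 ≤ δ) (s : I) : flarePath hcc hcc' q hδ s ∈ V :=
  flareExt_mem hq hc hc' _

/-- If flaring `q` gives a path homotopic in `U` to `q'`, then `q` and `q'` are freely homotopic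
in `U`, the endpoints moving along the two rays. -/
lemma exists_free_homotopy_of_cls_flarePath {U : Set X} (hcc : Continuous c) (hcc' : Continuous c')
    {q : Path (c t) (c' t)} (hq : ∀ s, q s ∈ U) (hc : ∀ u, t ≤ u → c u ∈ U)
    (hc' : ∀ u, t ≤ u → c' u ∈ U) {δ : ℝ} (hδ : 0 ≤ δ) {q' : Path (c (t + δ)) (c' (t + δ))}
    {hq' : ∀ s, q' s ∈ U}
    (h : cls (flarePath hcc hcc' q hδ) (flarePath_mem hq hc hc' hcc hcc' hδ) = cls q' hq') :
    ∃ (M : ℝ × I → X) (ψ : ℝ → ℝ), Continuous M ∧ Continuous ψ ∧ (∀ z, M z ∈ U) ∧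
      (∀ s, M (0, s) = q s) ∧ (∀ s, M (1, s) = q' s) ∧ ψ 0 = t ∧ ψ 1 = t + δ ∧ (∀ τ, t ≤ ψ τ) ∧
      (∀ τ, M (τ, 0) = c (ψ τ)) ∧ ∀ τ, M (τ, 1) = c' (ψ τ) := by
  obtain ⟨F, hF, hFU, hF0, hF1, hFl, hFr⟩ := exists_homotopy_of_cls_eq h
  let κ : ℝ → I := fun τ => projIcc 0 1 zero_le_one (2 * τ)
  have hκ : ∀ τ, ¬ τ ≤ 1 / 2 → κ τ = 1 := fun τ hτ => projIcc_of_right_le _ (by linarith)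
  have hκ' : ∀ τ, τ = 1 / 2 → κ τ = 1 := fun τ hτ => projIcc_of_right_le _ (by linarith)
  have hκc : Continuous κ := by fun_prop
  refine ⟨fun z => if z.1 ≤ 1 / 2 then flareExt q (z.2 + κ z.1 * δ * (2 * z.2 - 1))
      else F (projIcc 0 1 zero_le_one (2 * z.1 - 1), z.2), fun τ => t + κ τ * δ,
    Continuous.if_le ((continuous_flareExt hcc hcc' q).comp (by fun_prop))
      (hF.comp (by fun_prop)) continuous_fst continuous_const ?_, by fun_prop, fun z => ?_,
    fun s => ?_, fun s => ?_, ?_, ?_, fun τ => ?_, fun τ => ?_, fun τ => ?_⟩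
  · intro z hz
    rw [hκ' _ hz, projIcc_of_le_left _ (by linarith)]
    have := hF0 z.2
    rw [flarePath_apply] at this
    simpa using this.symm
  · dsimp only
    split_ifs
    · exact flareExt_mem hq hc hc' _
    · exact hFU _
  · simp [κ, flareExt_coe]
  · norm_num
    exact hF1 s
  · simp [κ]
  · simp [hκ 1 (by norm_num)]
  · have := mul_nonneg (κ τ).2.1 hδ
    linarith
  · have := mul_nonneg (κ τ).2.1 hδ
    dsimp only
    split_ifs with hτ
    · rw [flareExt_of_nonpos]
      · simp
      · simpa using this
    · rw [hκ τ hτ, hFl]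
      simp
  · have := mul_nonneg (κ τ).2.1 hδ
    dsimp only
    split_ifs with hτ
    · rw [flareExt_of_one_le]
      · norm_num
      · norm_num
        exact this
    · rw [hκ τ hτ, hFr]
      simp

end Flare

section OneEnd

variable {X : Type u} [MetricSpace X] [hX : Fact (IsCAT0Space X)]

lemma joinedIn_of_mem_connectedComponentIn {U : Set X} (hU : IsOpen U) {x y : X} (hx : x ∈ U)
    (hy : y ∈ connectedComponentIn U x) : JoinedIn U x y := by
  have : LocallyPathConnectedSpace X :=
    LocallyPathConnectedSpace.of_bases (fun x => Metric.nhds_basis_ball) fun x r hr =>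
      ⟨x, Metric.mem_ball_self hr, fun {y} hy =>
        ⟨geoPath x y, geo_mem_ball (Metric.mem_ball_self hr) hy⟩⟩
  have h := (hU.connectedComponentIn (x := x)).isConnected_iff_isPathConnected.1
    ⟨⟨x, mem_connectedComponentIn hx⟩, isPreconnected_connectedComponentIn⟩
  exact (h.joinedIn _ (mem_connectedComponentIn hx) _ hy).mono (connectedComponentIn_subset _ _)

lemma HasOneEnd.exists_joinedIn_out [ProperSpace X] (hone : HasOneEnd X) (x₀ : X) (κ : ℝ) :
    ∃ κ' : ℝ, ∀ x ∈ out x₀ κ', ∀ y ∈ out x₀ κ', JoinedIn (out x₀ κ) x y := by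
  obtain ⟨K, hK, hκK, h⟩ := hone.2 _ (isCompact_closedBall x₀ κ)
  obtain ⟨κ', hκ'⟩ := hK.isBounded.subset_closedBall x₀
  have hout : ∀ r, (Metric.closedBall x₀ r)ᶜ = out x₀ r := fun r => by
    ext z
    rw [mem_compl_iff, Metric.mem_closedBall', not_le]
    rfl
  have hK' : ∀ z ∈ out x₀ κ', z ∈ Kᶜ := fun z hz hzK => by
    rw [← hout] at hz
    exact hz (hκ' hzK)
  have hcomp : Kᶜ ⊆ out x₀ κ := by
    rw [← hout]
    exact compl_subset_compl.2 hκK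
  refine ⟨κ', fun x hx y hy => ?_⟩
  have hxy := h x (hK' x hx) y (hK' y hy)
  rw [hout] at hxy
  exact joinedIn_of_mem_connectedComponentIn (hout κ ▸ Metric.isClosed_closedBall.isOpen_compl)
    (hcomp (hK' x hx)) (hxy ▸ mem_connectedComponentIn (hcomp (hK' y hy)))

end OneEnd

section Ladder

variable {X : Type u} [MetricSpace X] [ProperSpace X] {x₀ : X}

/-- Rays joined by a sequence of paths diverging to infinity, consecutive paths being freely
homotopic along the rays, are properly homotopic. -/
lemma properlyHomotopic_of_ladder (c c' : ProperRay X) {M : ℕ → ℝ × I → X} {ψ : ℕ → ℝ → ℝ}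
    (hM : ∀ j, Continuous (M j)) (hψ : ∀ j, Continuous (ψ j)) (hout : ∀ (j : ℕ) z, M j z ∈ out x₀ j)
    (hglue : ∀ j s, M j (1, s) = M (j + 1) (0, s)) (hψglue : ∀ j, ψ j 1 = ψ (j + 1) 0)
    (hle : ∀ (j : ℕ) τ, j ≤ ψ j τ) (h0 : ∀ j τ, M j (τ, 0) = c.toFun (ψ j τ).toNNReal)
    (h1 : ∀ j τ, M j (τ, 1) = c'.toFun (ψ j τ).toNNReal) :
    ProperlyHomotopic c.toFun c'.toFun := by
  have hH := continuous_glue (f := fun (j : ℕ) τ (s : I) => M j (τ, s)) (fun j => hM j) hglue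
  have hφ := (continuous_glue (f := fun (j : ℕ) τ (_ : I) => ψ j τ)
    (fun j => (hψ j).comp continuous_fst) fun j _ => hψglue j).comp (Continuous.prodMk_left (0 : I))
  let φ : ℝ≥0 → ℝ≥0 := fun t => (ψ ⌊t⌋₊ ((t : ℝ) - ⌊t⌋₊)).toNNReal
  have hφc : Continuous φ := continuous_real_toNNReal.comp hφ
  have hφle : ∀ t, t ≤ φ t + 1 := fun t => by
    refine (Nat.lt_floor_add_one t).le.trans ?_
    gcongr
    refine NNReal.le_toNNReal_of_coe_le ?_
    rw [NNReal.coe_natCast]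
    exact hle _ _
  have hmid : ProperlyHomotopic (c.toFun ∘ φ) (c'.toFun ∘ φ) := by
    refine ⟨_, hH, isCompact_preimage_of_far (x₀ := x₀) hH fun κ => ⟨⌈κ⌉₊, fun t ht s => ?_⟩,
      fun t => h0 _ _, fun t => h1 _ _⟩
    refine out_anti x₀ ((Nat.le_ceil κ).trans ?_) (hout _ _)
    exact_mod_cast Nat.le_floor ht
  exact ((c.properlyHomotopic_comp hφc hφle).trans hmid).trans
    (c'.properlyHomotopic_comp hφc hφle).symm

variable [hX : Fact (IsCAT0Space X)]

/-- A one-ended proper CAT(0) space in which all geodesic rays from `x₀` are properly homotopic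
is semistable. -/
theorem properlyHomotopic_of_raySpace (hone : HasOneEnd X)
    (hgeo : ∀ ξ η : RaySpace x₀, ProperlyHomotopic ξ.1 η.1) (c c' : ProperRay X) :
    ProperlyHomotopic c.toFun c'.toFun := by
  choose R hmR R' hR' using fun j : ℕ => exists_repIn_out hone hgeo (j : ℝ≥0)
  simp only [NNReal.coe_natCast] at hmR
  obtain ⟨κ₀, hκ₀⟩ := hone.exists_joinedIn_out x₀ (R 0)
  let b : ℕ → ℝ := fun j => max (R j) (j.casesOn κ₀ fun i => R' i (R j))
  let γ : ℝ → X := fun u => c.toFun u.toNNReal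
  let γ' : ℝ → X := fun u => c'.toFun u.toNNReal
  have hγ : Continuous γ := c.continuous_toFun.comp continuous_real_toNNReal
  have hγ' : Continuous γ' := c'.continuous_toFun.comp continuous_real_toNNReal
  have hfar : ∀ j, ∃ T : ℝ≥0, ∀ u : ℝ, T ≤ u → γ u ∈ out x₀ (b j) ∧ γ' u ∈ out x₀ (b j) := by
    intro j
    obtain ⟨T, hT⟩ := c.exists_far x₀ (b j)
    obtain ⟨T', hT'⟩ := c'.exists_far x₀ (b j)
    refine ⟨max T T', fun u hu => ?_⟩
    have hu' := NNReal.le_toNNReal_of_coe_le hu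
    exact ⟨hT _ ((le_max_left _ _).trans hu'), hT' _ ((le_max_right _ _).trans hu')⟩
  choose T hT using hfar
  let t : ℕ → ℝ := fun j => Nat.rec (T 0 : ℝ) (fun i r => r + (T (i + 1) + 1)) j
  have ht_succ : ∀ j, t (j + 1) = t j + (T (j + 1) + 1) := fun j => rfl
  have hjt : ∀ j : ℕ, (j : ℝ) ≤ t j := fun j => by
    induction j with
    | zero => exact Nat.cast_zero.trans_le (T 0).2
    | succ j ih =>
      rw [ht_succ]
      push_cast
      linarith [(T (j + 1)).2]
  have hTt : ∀ j, T j ≤ t j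
    | 0 => le_rfl
    | j + 1 => by linarith [ht_succ j, hjt j, j.cast_nonneg (α := ℝ)]
  have hb : ∀ j u, t j ≤ u → γ u ∈ out x₀ (b j) ∧ γ' u ∈ out x₀ (b j) :=
    fun j u hu => hT j u ((hTt j).trans hu)
  have hRb : ∀ j, out x₀ (b j) ⊆ out x₀ (R j) := fun j => out_anti x₀ (le_max_left _ _)
  have hjR : ∀ j : ℕ, out x₀ (R j) ⊆ out x₀ j := fun j => out_anti x₀ (hmR j)
  let P : ℕ → Type u := fun j => {q : Path (γ (t j)) (γ' (t j)) // ∀ s, q s ∈ out x₀ (R j)}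
  have q₀ : P 0 := by
    have hbκ : out x₀ (b 0) ⊆ out x₀ κ₀ := out_anti x₀ (le_max_right _ _)
    have := hκ₀ _ (hbκ (hb 0 _ le_rfl).1) _ (hbκ (hb 0 _ le_rfl).2)
    exact ⟨this.somePath, this.somePath_mem⟩
  have step : ∀ j (q : P j), ∃ (q' : P (j + 1)) (M : ℝ × I → X) (ψ : ℝ → ℝ), Continuous M ∧
      Continuous ψ ∧ (∀ z, M z ∈ out x₀ j) ∧ (∀ s, M (0, s) = q.1 s) ∧ (∀ s, M (1, s) = q'.1 s) ∧
      ψ 0 = t j ∧ ψ 1 = t (j + 1) ∧ (∀ τ, t j ≤ ψ τ) ∧ (∀ τ, M (τ, 0) = γ (ψ τ)) ∧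
      ∀ τ, M (τ, 1) = γ' (ψ τ) := by
    rintro j ⟨q, hq⟩
    have hδ : (0 : ℝ) ≤ T (j + 1) + 1 := by positivity
    have hbR : out x₀ (b (j + 1)) ⊆ out x₀ (R' j (R (j + 1))) := out_anti x₀ (le_max_right _ _)
    have hend := hb (j + 1) _ le_rfl
    have hfl := flarePath_mem hq (fun u hu => hRb j (hb j u hu).1) (fun u hu => hRb j (hb j u hu).2)
      hγ hγ' hδ
    obtain ⟨q', hq'R, hq', hcls⟩ := hR' j (R (j + 1)) _ _ _ hfl (hbR hend.1) (hbR hend.2)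
      fun s => out_anti x₀ (by simpa using hmR j) (hfl s)
    obtain ⟨M, ψ, h⟩ := exists_free_homotopy_of_cls_flarePath hγ hγ'
      (fun s => out_anti x₀ (by simpa using hmR j) (hq s))
      (fun u hu => out_anti x₀ (by simpa using hmR j) (hRb j (hb j u hu).1))
      (fun u hu => out_anti x₀ (by simpa using hmR j) (hRb j (hb j u hu).2)) hδ hcls.symm
    exact ⟨⟨q', hq'R⟩, M, ψ, by simpa using h⟩
  choose next M ψ hM hψ hMout hM0 hM1 hψ0 hψ1 hψle hMl hMr using step
  let q : ∀ j, P j := fun j => Nat.rec q₀ next j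
  exact properlyHomotopic_of_ladder (x₀ := x₀) c c' (M := fun j => M j (q j))
    (ψ := fun j => ψ j (q j)) (fun j => hM _ _) (fun j => hψ _ _) (fun j => hMout _ _)
    (fun j s => (hM1 _ _ s).trans (hM0 (j + 1) _ s).symm)
    (fun j => (hψ1 _ _).trans (hψ0 (j + 1) _).symm)
    (fun j τ => (hjt j).trans (hψle _ _ τ)) (fun j => hMl _ _) fun j => hMr _ _

end Ladder

/-- If any two geodesic rays in the one-ended proper CAT(0) space `X` are properly homotopic,
and every strong shape component of `∂X` is non-empty (every proper ray is properly homotopic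
to a proper ray ending at a point of `∂X`), then `X` has semistable fundamental group at
infinity: any two proper rays in `X` are properly homotopic. -/
theorem semistable_of_geodesics_properly_homotopic_of_no_empty_components
    {X : Type*} [MetricSpace X] [ProperSpace X]
    (hX : IsCAT0Space X) (hone : HasOneEnd X)
    (B : BoundaryCompactification X)
    (hgeo : ∀ γ γ' : GeodesicRay X, ProperlyHomotopic γ.toFun γ'.toFun)
    (hnonempty : ∀ c : ProperRay X, ∃ (c' : ProperRay X) (p : B.carrier),
      ProperlyHomotopic c.toFun c'.toFun ∧ B.EndsAt c'.toFun p) :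
    ∀ c c' : ProperRay X, ProperlyHomotopic c.toFun c'.toFun := by
  have : Fact (IsCAT0Space X) := ⟨hX⟩
  intro c c'
  exact properlyHomotopic_of_raySpace (x₀ := c.toFun 0) hone
    (fun ξ η => hgeo ⟨ξ.1, ξ.2.2⟩ ⟨η.1, η.2.2⟩) c c'
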